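/- Let 2 ≤ q ≤ p < ∞ and let (Ω,ν) be a measure space. There is a constant C = C(p,q) such that for every n ∈ ℕ and all functions f_1,…,f_n : {-1,1}^n → L^q(ν), one has E_ε‖Σ_{i=1}^n Δ^{-1/2} D_i f_i‖_{L^q(ν)}^p ≤ C · E_{δ,ε}‖Σ_{i=1}^n δ_i D_i f_i(ε)‖_{L^q(ν)}^p. -/

import Mathlib

open scoped BigOperators
open Finset

noncomputable section

/-- The ±1 value of a Boolean coordinate. -/
def rad (b : Bool) : ℝ := if b then 1 else -1

/-- Expectation over the uniform measure on the discrete cube `{-1,1}^n`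
(points encoded as `Fin n → Bool`). -/
def cubeAvg {n : ℕ} {X : Type*} [AddCommGroup X] [Module ℝ X]
    (f : (Fin n → Bool) → X) : X :=
  ((2 ^ n : ℝ)⁻¹) • ∑ ε : Fin n → Bool, f ε

/-- Walsh character `w_A(ε) = ∏_{i ∈ A} ε_i`. -/
def walshChar {n : ℕ} (A : Finset (Fin n)) (ε : Fin n → Bool) : ℝ :=
  ∏ i ∈ A, rad (ε i)

/-- Walsh coefficient `f̂(A) = E_ε [f(ε) w_A(ε)]`. -/
def wcoef {n : ℕ} {X : Type*} [AddCommGroup X] [Module ℝ X]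
    (f : (Fin n → Bool) → X) (A : Finset (Fin n)) : X :=
  cubeAvg (fun ε => walshChar A ε • f ε)

/-- Flip the `j`-th coordinate. -/
def flipCoord {n : ℕ} (j : Fin n) (ε : Fin n → Bool) : Fin n → Bool :=
  Function.update ε j (!(ε j))

/-- Discrete derivative `D_j f(ε) = (f(ε) - f(σ_j ε))/2`. -/
def Dop {n : ℕ} {X : Type*} [AddCommGroup X] [Module ℝ X]
    (j : Fin n) (f : (Fin n → Bool) → X) : (Fin n → Bool) → X :=
  fun ε => (2 : ℝ)⁻¹ • (f ε - f (flipCoord j ε))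

/-- Heat semigroup `P_t f = Σ_A e^{-t|A|} f̂(A) w_A`. -/
def heatOp {n : ℕ} {X : Type*} [AddCommGroup X] [Module ℝ X]
    (t : ℝ) (f : (Fin n → Bool) → X) : (Fin n → Bool) → X :=
  fun ε => ∑ A : Finset (Fin n), (Real.exp (-t * A.card) * walshChar A ε) • wcoef f A

/-- Fractional power of the Laplacian on mean-zero parts:
`Δ^a f = Σ_{A ≠ ∅} |A|^a f̂(A) w_A`. -/
def lapPow {n : ℕ} {X : Type*} [AddCommGroup X] [Module ℝ X]
    (a : ℝ) (f : (Fin n → Bool) → X) : (Fin n → Bool) → X :=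
  fun ε => ∑ A ∈ Finset.univ.filter (fun A : Finset (Fin n) => A ≠ ∅),
    (((A.card : ℝ)) ^ a * walshChar A ε) • wcoef f A

/-- `X` has cotype `q` with constant `K`. -/
def HasCotypeConst (X : Type*) [NormedAddCommGroup X] [NormedSpace ℝ X] (q K : ℝ) : Prop :=
  ∀ m : ℕ, ∀ x : Fin m → X,
    (∑ j, ‖x j‖ ^ q) ^ (1 / q) ≤
      K * (cubeAvg (fun δ : Fin m → Bool => ‖∑ j, rad (δ j) • x j‖ ^ (2 : ℝ))) ^ (1 / 2 : ℝ)

/-- `X` has type `s` with constant `T`. -/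
def HasTypeConst (X : Type*) [NormedAddCommGroup X] [NormedSpace ℝ X] (s T : ℝ) : Prop :=
  ∀ m : ℕ, ∀ x : Fin m → X,
    (cubeAvg (fun δ : Fin m → Bool => ‖∑ j, rad (δ j) • x j‖ ^ (2 : ℝ))) ^ (1 / 2 : ℝ) ≤
      T * (∑ j, ‖x j‖ ^ s) ^ (1 / s)

noncomputable section

lemma rad_not (b : Bool) : rad (!b) = - rad b := by cases b <;> simp [rad]
lemma rad_mul_self (b : Bool) : rad b * rad b = 1 := by cases b <;> simp [rad]

lemma cflip_flip {n : ℕ} (j : Fin n) (ε : Fin n → Bool) : flipCoord j (flipCoord j ε) = ε := by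
  unfold flipCoord; simp

lemma csum_flip {n : ℕ} {X : Type*} [AddCommMonoid X] (j : Fin n) (f : (Fin n → Bool) → X) :
    ∑ ε, f (flipCoord j ε) = ∑ ε, f ε :=
  Fintype.sum_equiv (Function.Involutive.toPerm (flipCoord j) (cflip_flip j)) _ _ (fun _ => rfl)

lemma walsh_flip {n : ℕ} (A : Finset (Fin n)) (j : Fin n) (ε : Fin n → Bool) :
    walshChar A (flipCoord j ε) = if j ∈ A then - walshChar A ε else walshChar A ε := by
  unfold walshChar flipCoord
  split_ifs with h
  · rw [← Finset.mul_prod_erase A _ h, ← Finset.mul_prod_erase A (fun i => rad (ε i)) h]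
    rw [Function.update_self, rad_not, neg_mul]
    congr 2
    apply Finset.prod_congr rfl
    intro i hi
    rw [Function.update_of_ne (Finset.ne_of_mem_erase hi)]
  · apply Finset.prod_congr rfl
    intro i hi
    rw [Function.update_of_ne]
    rintro rfl; exact h hi

lemma walsh_mul_self {n : ℕ} (A : Finset (Fin n)) (ε : Fin n → Bool) :
    walshChar A ε * walshChar A ε = 1 := by
  unfold walshChar
  rw [← Finset.prod_mul_distrib]
  exact Finset.prod_eq_one (fun i _ => rad_mul_self _)

lemma card_cube (n : ℕ) : ∑ _ε : Fin n → Bool, (1:ℝ) = 2 ^ n := by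
  simp

lemma walsh_orth {n : ℕ} (A B : Finset (Fin n)) :
    ∑ ε, walshChar A ε * walshChar B ε = if A = B then (2:ℝ) ^ n else 0 := by
  split_ifs with h
  · subst h
    simp [walsh_mul_self]
  · have : ∃ i, ¬ (i ∈ A ↔ i ∈ B) := by
      by_contra hh; push Not at hh; exact h (Finset.ext hh)
    obtain ⟨i, hi⟩ := this
    have h1 := csum_flip i (fun ε => walshChar A ε * walshChar B ε)
    have h2 : ∀ ε, walshChar A (flipCoord i ε) * walshChar B (flipCoord i ε)
        = - (walshChar A ε * walshChar B ε) := by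
      intro ε
      rw [walsh_flip, walsh_flip]
      by_cases ha : i ∈ A <;> by_cases hb : i ∈ B <;> simp_all
    simp only [h2, Finset.sum_neg_distrib] at h1
    linarith

lemma walsh_complete {n : ℕ} (ε δ : Fin n → Bool) :
    ∑ A : Finset (Fin n), walshChar A ε * walshChar A δ = if ε = δ then (2:ℝ) ^ n else 0 := by
  have h : ∑ A : Finset (Fin n), walshChar A ε * walshChar A δ
      = ∏ i, (1 + rad (ε i) * rad (δ i)) := by
    rw [Finset.prod_one_add]
    simp [walshChar, Finset.prod_mul_distrib]
  rw [h]
  split_ifs with h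
  · subst h
    simp only [rad_mul_self]
    norm_num
  · obtain ⟨i, hi⟩ := Function.ne_iff.mp h
    apply Finset.prod_eq_zero (Finset.mem_univ i)
    cases h1 : ε i <;> cases h2 : δ i <;> simp_all [rad]

/-- Fourier multiplier. -/
def mult {n : ℕ} (m : Finset (Fin n) → ℝ) (f : (Fin n → Bool) → ℝ) : (Fin n → Bool) → ℝ :=
  fun ε => ∑ A : Finset (Fin n), m A * walshChar A ε * wcoef f A

lemma wcoef_real {n : ℕ} (f : (Fin n → Bool) → ℝ) (A) :
    wcoef f A = (2 ^ n : ℝ)⁻¹ * ∑ ε, walshChar A ε * f ε := by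
  simp [wcoef, cubeAvg]

lemma mult_one {n : ℕ} (f : (Fin n → Bool) → ℝ) : mult (fun _ => 1) f = f := by
  funext ε
  simp only [mult, wcoef_real, one_mul, Finset.mul_sum]
  rw [Finset.sum_comm]
  have : ∀ δ, ∑ A, walshChar A ε * ((2 ^ n : ℝ)⁻¹ * (walshChar A δ * f δ))
     = (2 ^ n : ℝ)⁻¹ * f δ * (if ε = δ then (2:ℝ)^n else 0) := by
    intro δ
    rw [← walsh_complete, Finset.mul_sum]
    exact Finset.sum_congr rfl (fun _ _ => by ring)
  simp only [this]
  simp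
  field_simp

lemma wcoef_mult {n : ℕ} (m) (f : (Fin n → Bool) → ℝ) (A) : wcoef (mult m f) A = m A * wcoef f A := by
  rw [wcoef_real]
  simp only [mult, Finset.mul_sum]
  rw [Finset.sum_comm]
  have : ∀ B, ∑ ε, (2 ^ n : ℝ)⁻¹ * (walshChar A ε * (m B * walshChar B ε * wcoef f B))
     = (2 ^ n : ℝ)⁻¹ * m B * wcoef f B * (if A = B then (2:ℝ)^n else 0) := by
    intro B
    rw [← walsh_orth, Finset.mul_sum]
    exact Finset.sum_congr rfl (fun _ _ => by ring)
  simp only [this]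
  simp
  field_simp

lemma mult_mult {n : ℕ} (m m') (f : (Fin n → Bool) → ℝ) :
    mult m (mult m' f) = mult (fun A => m A * m' A) f := by
  funext ε
  simp only [mult.eq_1 m (mult m' f), wcoef_mult]
  unfold mult
  exact Finset.sum_congr rfl (fun _ _ => by ring)

lemma mult_selfadj {n : ℕ} (m) (f g : (Fin n → Bool) → ℝ) :
    ∑ ε, mult m f ε * g ε = ∑ ε, f ε * mult m g ε := by
  have key : ∀ f g : (Fin n → Bool) → ℝ,
      ∑ ε, mult m f ε * g ε = 2 ^ n * ∑ A, m A * wcoef f A * wcoef g A := by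
    intro f g
    simp only [mult, Finset.sum_mul]
    rw [Finset.sum_comm, Finset.mul_sum]
    apply Finset.sum_congr rfl
    intro A _
    rw [wcoef_real g, Finset.mul_sum, Finset.mul_sum, Finset.mul_sum]
    apply Finset.sum_congr rfl
    intro ε _
    field_simp
  rw [key]
  simp only [mul_comm (f _)]
  rw [key]
  congr 1
  exact Finset.sum_congr rfl (fun _ _ => by ring)

lemma wcoef_flip {n : ℕ} (j : Fin n) (f : (Fin n → Bool) → ℝ) (A) :
    wcoef (fun ε => f (flipCoord j ε)) A = if j ∈ A then - wcoef f A else wcoef f A := by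
  rw [wcoef_real, wcoef_real, ← csum_flip j]
  simp only [cflip_flip, walsh_flip]
  split_ifs <;> simp

lemma mult_flip {n : ℕ} (j : Fin n) (m) (f : (Fin n → Bool) → ℝ) (ε) :
    mult m f (flipCoord j ε) = mult m (fun ε => f (flipCoord j ε)) ε := by
  unfold mult
  apply Finset.sum_congr rfl
  intro A _
  rw [wcoef_flip, walsh_flip]
  split_ifs <;> ring

lemma mult_add {n : ℕ} (m) (f g : (Fin n → Bool) → ℝ) (ε) :
    mult m (fun ε => f ε + g ε) ε = mult m f ε + mult m g ε := by
  unfold mult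
  rw [← Finset.sum_add_distrib]
  apply Finset.sum_congr rfl
  intro A _
  rw [wcoef_real, wcoef_real f, wcoef_real g]
  simp only [mul_add, Finset.sum_add_distrib]

lemma mult_smul {n : ℕ} (m) (c : ℝ) (f : (Fin n → Bool) → ℝ) (ε) :
    mult m (fun ε => c * f ε) ε = c * mult m f ε := by
  unfold mult
  rw [Finset.mul_sum]
  apply Finset.sum_congr rfl
  intro A _
  rw [wcoef_real, wcoef_real f]
  simp only [Finset.mul_sum]
  exact Finset.sum_congr rfl (fun _ _ => by ring)

lemma mult_sum {n : ℕ} {ι : Type*} [Fintype ι] (m) (f : ι → (Fin n → Bool) → ℝ) (ε) :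
    mult m (fun ε => ∑ i, f i ε) ε = ∑ i, mult m (f i) ε := by
  unfold mult
  rw [Finset.sum_comm]
  apply Finset.sum_congr rfl
  intro A _
  rw [← Finset.mul_sum]
  congr 1
  simp only [wcoef_real, Finset.mul_sum]
  rw [Finset.sum_comm]

/-- Poisson symbol -/
def psym {n : ℕ} (t : ℝ) (A : Finset (Fin n)) : ℝ := Real.exp (-t * Real.sqrt A.card)

/-- sum of discrete derivatives -/
lemma lap_mult {n : ℕ} (m) (f : (Fin n → Bool) → ℝ) (ε) :
    ∑ i, (2:ℝ)⁻¹ * (mult m f ε - mult m f (flipCoord i ε)) = mult (fun A => A.card * m A) f ε := by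
  unfold mult
  simp only [← Finset.sum_sub_distrib, Finset.mul_sum]
  rw [Finset.sum_comm]
  apply Finset.sum_congr rfl
  intro A _
  have : ∀ i, (2:ℝ)⁻¹ * (m A * walshChar A ε * wcoef f A - m A * walshChar A (flipCoord i ε) * wcoef f A)
     = if i ∈ A then m A * walshChar A ε * wcoef f A else 0 := by
    intro i
    rw [walsh_flip]; split_ifs <;> ring
  simp only [this]
  rw [Finset.sum_ite_mem]
  simp
  ring

/-- kernel -/
def pker {n : ℕ} (m : Finset (Fin n) → ℝ) (ε δ : Fin n → Bool) : ℝ :=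
  (2 ^ n : ℝ)⁻¹ * ∑ A, m A * walshChar A ε * walshChar A δ

lemma mult_eq_ker {n : ℕ} (m) (f : (Fin n → Bool) → ℝ) (ε) :
    mult m f ε = ∑ δ, pker m ε δ * f δ := by
  unfold mult pker
  simp only [wcoef_real, Finset.mul_sum, Finset.sum_mul]
  rw [Finset.sum_comm]
  exact Finset.sum_congr rfl (fun _ _ => Finset.sum_congr rfl (fun _ _ => by ring))

lemma pker_eq_mult {n : ℕ} (m : Finset (Fin n) → ℝ) (δ : Fin n → Bool) (ε) :
    pker m ε δ = mult m (Pi.single δ 1) ε := by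
  rw [mult_eq_ker, Finset.sum_eq_single δ] <;> simp +contextual

lemma mult_const {n : ℕ} (m : Finset (Fin n) → ℝ) (ε) : mult m (fun _ => 1) ε = m ∅ := by
  unfold mult
  have : ∀ A : Finset (Fin n), wcoef (fun _ : Fin n → Bool => (1:ℝ)) A = if A = ∅ then 1 else 0 := by
    intro A
    have := walsh_orth A ∅
    rw [wcoef_real]
    have h0 : ∀ ε : Fin n → Bool, walshChar ∅ ε = 1 := by simp [walshChar]
    simp only [h0] at this
    rw [this]; split_ifs <;> simp
  simp only [this]
  simp [walshChar]

lemma pker_sum {n : ℕ} (t : ℝ) (ε : Fin n → Bool) : ∑ δ, pker (psym t) ε δ = 1 := by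
  have := mult_eq_ker (psym t) (fun _ => 1) ε
  rw [mult_const] at this
  simpa [psym] using this.symm

lemma mult_hasDeriv {n : ℕ} (m m' : ℝ → Finset (Fin n) → ℝ) (t : ℝ)
    (h : ∀ A, HasDerivAt (fun t => m t A) (m' t A) t) (f : (Fin n → Bool) → ℝ) (ε) :
    HasDerivAt (fun t => mult (m t) f ε) (mult (m' t) f ε) t := by
  unfold mult
  apply HasDerivAt.fun_sum
  intro A _
  exact ((h A).mul_const _).mul_const _

/-- first and second derivative symbols -/
def psym1 {n : ℕ} (t : ℝ) (A : Finset (Fin n)) : ℝ := - Real.sqrt A.card * Real.exp (-t * Real.sqrt A.card)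
def psym2 {n : ℕ} (t : ℝ) (A : Finset (Fin n)) : ℝ := (A.card : ℝ) * Real.exp (-t * Real.sqrt A.card)

lemma psym_deriv {n : ℕ} (t : ℝ) (A : Finset (Fin n)) : HasDerivAt (fun t => psym t A) (psym1 t A) t := by
  unfold psym psym1
  have := ((hasDerivAt_id t).neg.mul_const (Real.sqrt A.card)).exp
  simp only [Pi.neg_apply, id] at this
  exact this.congr_deriv (by ring)

lemma psym1_deriv {n : ℕ} (t : ℝ) (A : Finset (Fin n)) : HasDerivAt (fun t => psym1 t A) (psym2 t A) t := by
  have := (psym_deriv t A).const_mul (- Real.sqrt A.card)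
  unfold psym psym1 at this
  unfold psym1 psym2
  refine this.congr_deriv ?_
  have := Real.mul_self_sqrt (Nat.cast_nonneg (α := ℝ) A.card)
  linear_combination (Real.exp (-t * Real.sqrt A.card)) * this

lemma psym_tendsto {n : ℕ} (A : Finset (Fin n)) :
    Filter.Tendsto (fun t => psym t A) Filter.atTop (nhds (if A = ∅ then 1 else 0)) := by
  split_ifs with h
  · subst h; simp [psym]
  · unfold psym
    apply Real.tendsto_exp_atBot.comp
    have : 0 < Real.sqrt A.card := Real.sqrt_pos.mpr (by exact_mod_cast Finset.card_pos.mpr (Finset.nonempty_iff_ne_empty.mpr h))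
    exact Filter.Tendsto.atBot_mul_const this Filter.tendsto_neg_atTop_atBot

lemma mult_tendsto {n : ℕ} (f : (Fin n → Bool) → ℝ) (ε) :
    Filter.Tendsto (fun t => mult (psym t) f ε) Filter.atTop (nhds (mult (fun A => if A = ∅ then 1 else 0) f ε)) := by
  unfold mult
  apply tendsto_finsetSum
  intro A _
  exact ((psym_tendsto A).mul_const _).mul_const _

lemma mult_zero_sym {n : ℕ} (f : (Fin n → Bool) → ℝ) (ε) :
    mult (fun A => if A = ∅ then 1 else 0) f ε = wcoef f ∅ := by
  unfold mult; simp [walshChar]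

lemma psym_zero {n : ℕ} : psym (n := n) 0 = fun _ => 1 := by funext A; simp [psym]

/-- Maximum principle. -/
lemma poisson_nonneg {n : ℕ} (f : (Fin n → Bool) → ℝ) (hf : ∀ ε, 0 ≤ f ε) (t : ℝ) (ht : 0 ≤ t) (ε) :
    0 ≤ mult (psym t) f ε := by
  by_contra hneg
  push Not at hneg
  set u : ℝ → (Fin n → Bool) → ℝ := fun t ε => mult (psym t) f ε with hu
  have hu0 : ∀ ε, u 0 ε = f ε := by intro ε; simp [hu, psym_zero, mult_one]
  set η : ℝ := - u t ε / 4 with hη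
  have hηpos : 0 < η := by simp only [hη]; linarith
  set v : ℝ → (Fin n → Bool) → ℝ := fun t ε => u t ε + η * (2 - Real.exp (-t)) with hv
  have hvd : ∀ t ε, HasDerivAt (fun t => v t ε) (mult (psym1 t) f ε + η * Real.exp (-t)) t := by
    intro t ε
    have h1 := mult_hasDeriv (n := n) psym psym1 t (psym_deriv t) f ε
    have h2 : HasDerivAt (fun t : ℝ => Real.exp (-t)) (-Real.exp (-t)) t := by
      simpa using (hasDerivAt_neg t).exp
    exact (h1.add ((h2.const_sub 2).const_mul η)).congr_deriv (by ring)
  have hvd2 : ∀ t ε, HasDerivAt (fun t => mult (psym1 t) f ε + η * Real.exp (-t))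
      (mult (psym2 t) f ε - η * Real.exp (-t)) t := by
    intro t ε
    have h1 := mult_hasDeriv (n := n) psym1 psym2 t (psym1_deriv t) f ε
    have h2 : HasDerivAt (fun t : ℝ => Real.exp (-t)) (-Real.exp (-t)) t := by
      simpa using (hasDerivAt_neg t).exp
    exact (h1.add (h2.const_mul η)).congr_deriv (by ring)
  have hvneg : v t ε < 0 := by
    have := Real.exp_pos (-t)
    simp only [hv, hη]
    nlinarith [hneg]
  have hlim : ∀ δ, Filter.Tendsto (fun t => v t δ) Filter.atTop (nhds (wcoef f ∅ + η * 2)) := by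
    intro δ
    have h1 := mult_tendsto f δ
    rw [mult_zero_sym] at h1
    have h2 : Filter.Tendsto (fun t : ℝ => Real.exp (-t)) Filter.atTop (nhds 0) :=
      Real.tendsto_exp_atBot.comp Filter.tendsto_neg_atTop_atBot
    have := h1.add ((h2.const_sub 2).const_mul η)
    simpa using this
  have hmean : 0 ≤ wcoef f ∅ := by
    rw [wcoef_real]
    have : ∀ ε : Fin n → Bool, walshChar ∅ ε = 1 := by simp [walshChar]
    simp only [this, one_mul]
    exact mul_nonneg (by positivity) (Finset.sum_nonneg (fun _ _ => hf _))
  have hev : ∀ᶠ s in Filter.atTop, ∀ δ, 0 < v s δ := by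
    rw [Filter.eventually_all]
    intro δ
    exact (hlim δ).eventually (lt_mem_nhds (by linarith))
  obtain ⟨T, hT⟩ := Filter.eventually_atTop.mp hev
  set T' := max T t
  have hT' : ∀ δ, 0 < v T' δ := hT T' (le_max_left _ _)
  have hcont : ∀ δ, Continuous (fun t => v t δ) := fun δ =>
    continuous_iff_continuousAt.mpr (fun t => (hvd t δ).continuousAt)
  have hmin : ∀ δ, ∃ s ∈ Set.Icc 0 T', ∀ r ∈ Set.Icc 0 T', v s δ ≤ v r δ := by
    intro δ
    have := (isCompact_Icc (a := (0:ℝ)) (b := T')).exists_isMinOn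
      ⟨0, Set.left_mem_Icc.mpr (ht.trans (le_max_right _ _))⟩ (hcont δ).continuousOn
    obtain ⟨s, hs, h⟩ := this
    exact ⟨s, hs, fun r hr => h hr⟩
  choose s hs hsmin using hmin
  obtain ⟨δ, -, hδ⟩ := Finset.exists_min_image Finset.univ (fun δ => v (s δ) δ) ⟨ε, Finset.mem_univ _⟩
  have hglob : ∀ δ', ∀ r ∈ Set.Icc 0 T', v (s δ) δ ≤ v r δ' := fun δ' r hr =>
    (hδ δ' (Finset.mem_univ _)).trans (hsmin δ' r hr)
  have hneg' : v (s δ) δ < 0 := (hglob ε t ⟨ht, le_max_right _ _⟩).trans_lt hvneg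
  have h0 : 0 < s δ := by
    rcases (hs δ).1.eq_or_lt with h | h
    · exfalso
      rw [← h] at hneg'
      simp only [hv, hu0] at hneg'
      have := hf δ
      simp at hneg'
      linarith
    · exact h
  have h1 : s δ < T' := by
    rcases (hs δ).2.eq_or_lt with h | h
    · exfalso
      rw [h] at hneg'
      exact absurd (hT' δ) (not_lt.mpr hneg'.le)
    · exact h
  -- second derivative
  have hlap : mult (psym2 (s δ)) f δ ≤ 0 := by
    have := lap_mult (psym (s δ)) f δ
    have he : (fun A : Finset (Fin n) => (A.card : ℝ) * psym (s δ) A) = psym2 (s δ) := rfl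
    rw [he] at this
    rw [← this]
    apply Finset.sum_nonpos
    intro i _
    have := hglob (flipCoord i δ) (s δ) (hs δ)
    simp only [hv, hu] at this
    linarith
  have hsec : mult (psym2 (s δ)) f δ - η * Real.exp (-(s δ)) < 0 := by
    have := mul_pos hηpos (Real.exp_pos (-(s δ)))
    linarith
  have hloc : IsLocalMin (fun t => v t δ) (s δ) := by
    filter_upwards [Icc_mem_nhds h0 h1] with r hr using hglob δ r hr
  have hd0 := hloc.hasDerivAt_eq_zero (hvd (s δ) δ)
  -- derivative strictly decreasing near s, so v decreases to the right
  have hder : deriv (fun t => v t δ) = fun t => mult (psym1 t) f δ + η * Real.exp (-t) := by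
    funext t; exact (hvd t δ).deriv
  have hmax : ∀ᶠ r in nhdsWithin (s δ) (Set.Ioi (s δ)), deriv (fun t => v t δ) r < 0 := by
    have hsl := (hasDerivAt_iff_tendsto_slope.mp (hvd2 (s δ) δ)).eventually (gt_mem_nhds hsec)
    have hsl2 := hsl.filter_mono (nhdsWithin_mono (s δ) (fun x (hx : s δ < x) => (ne_of_gt hx : x ≠ s δ)))
    filter_upwards [hsl2, self_mem_nhdsWithin] with r hr (hr2 : s δ < r)
    rw [slope_def_field, hd0, sub_zero] at hr
    rw [hder]
    by_contra hcon
    push Not at hcon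
    exact absurd hr (not_lt.mpr (div_nonneg hcon (sub_nonneg.mpr hr2.le)))
  obtain ⟨b, hb, hbd⟩ := (mem_nhdsGT_iff_exists_Ioo_subset).mp hmax
  have hb' : s δ < min b T' := lt_min hb h1
  have hanti : StrictAntiOn (fun t => v t δ) (Set.Icc (s δ) (min b T')) := by
    apply strictAntiOn_of_deriv_neg (convex_Icc _ _) (hcont δ).continuousOn
    intro x hx
    rw [interior_Icc] at hx
    exact hbd ⟨hx.1, hx.2.trans_le (min_le_left _ _)⟩
  have := hanti (Set.left_mem_Icc.mpr hb'.le) (Set.right_mem_Icc.mpr hb'.le) hb'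
  exact absurd this (not_lt.mpr (hglob δ _ ⟨h0.le.trans hb'.le, min_le_right _ _⟩))

lemma pker_nonneg {n : ℕ} (t : ℝ) (ht : 0 ≤ t) (ε δ : Fin n → Bool) : 0 ≤ pker (psym t) ε δ := by
  rw [pker_eq_mult]
  apply poisson_nonneg _ _ t ht
  intro ε
  by_cases h : ε = δ
  · subst h; simp
  · simp [h]
end

noncomputable section

def hess {E : Type*} [NormedAddCommGroup E] [NormedSpace ℝ E] (P : E → ℝ) (x y : E) : ℝ :=
  fderiv ℝ (fderiv ℝ P) x y y

def flow {n : ℕ} {E : Type*} [NormedAddCommGroup E] [NormedSpace ℝ E] (x0 : (Fin n → Bool) → E)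
    (m : Finset (Fin n) → ℝ) (ε : Fin n → Bool) : E := ∑ δ, pker m ε δ • x0 δ

section
variable {n : ℕ} {E : Type*} [NormedAddCommGroup E] [NormedSpace ℝ E]

lemma pker_deriv (t : ℝ) (ε δ : Fin n → Bool) :
    HasDerivAt (fun t => pker (psym t) ε δ) (pker (psym1 t) ε δ) t := by
  simp only [pker_eq_mult]
  exact mult_hasDeriv psym psym1 t (psym_deriv t) _ ε

lemma pker1_deriv (t : ℝ) (ε δ : Fin n → Bool) :
    HasDerivAt (fun t => pker (psym1 t) ε δ) (pker (psym2 t) ε δ) t := by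
  simp only [pker_eq_mult]
  exact mult_hasDeriv psym1 psym2 t (psym1_deriv t) _ ε

lemma flow_deriv (x0 : (Fin n → Bool) → E) (t : ℝ) (ε) :
    HasDerivAt (fun t => flow x0 (psym t) ε) (flow x0 (psym1 t) ε) t := by
  unfold flow
  exact HasDerivAt.fun_sum (fun δ _ => (pker_deriv t ε δ).smul_const _)

lemma flow1_deriv (x0 : (Fin n → Bool) → E) (t : ℝ) (ε) :
    HasDerivAt (fun t => flow x0 (psym1 t) ε) (flow x0 (psym2 t) ε) t := by
  unfold flow
  exact HasDerivAt.fun_sum (fun δ _ => (pker1_deriv t ε δ).smul_const _)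

lemma flow_zero (x0 : (Fin n → Bool) → E) (ε) : flow x0 (psym 0) ε = x0 ε := by
  unfold flow
  rw [Finset.sum_eq_single ε]
  · simp [pker_eq_mult, psym_zero, mult_one]
  · intro δ _ h
    simp [pker_eq_mult, psym_zero, mult_one, h.symm]
  · simp

lemma flow_tendsto (x0 : (Fin n → Bool) → E) (ε) :
    Filter.Tendsto (fun t => flow x0 (psym t) ε) Filter.atTop
      (nhds (flow x0 (fun A => if A = ∅ then 1 else 0) ε)) := by
  unfold flow
  apply tendsto_finsetSum
  intro δ _
  apply Filter.Tendsto.smul_const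
  simp only [pker_eq_mult]
  exact mult_tendsto _ _

lemma flow_lap (x0 : (Fin n → Bool) → E) (t : ℝ) (ε) :
    flow x0 (psym2 t) ε
      = ∑ i, (2:ℝ)⁻¹ • (flow x0 (psym t) ε - flow x0 (psym t) (flipCoord i ε)) := by
  unfold flow
  simp only [← Finset.sum_sub_distrib, ← sub_smul, Finset.smul_sum, smul_smul]
  rw [Finset.sum_comm]
  apply Finset.sum_congr rfl
  intro δ _
  rw [← Finset.sum_smul]
  congr 1
  simp only [pker_eq_mult]
  rw [lap_mult]; rfl

lemma flow_mem (x0 : (Fin n → Bool) → E) {D : Set E} (hD : Convex ℝ D) (h0 : ∀ ε, x0 ε ∈ D)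
    (t : ℝ) (ht : 0 ≤ t) (ε) : flow x0 (psym t) ε ∈ D :=
  hD.sum_mem (fun δ _ => pker_nonneg t ht ε δ) (pker_sum t ε) (fun δ _ => h0 δ)

lemma flow_clm (x0 : (Fin n → Bool) → E) (L : E →ₗ[ℝ] ℝ) (m) (ε) :
    L (flow x0 m ε) = mult m (fun δ => L (x0 δ)) ε := by
  unfold flow
  rw [mult_eq_ker]
  simp

lemma c2_fderiv {P : E → ℝ} {U : Set E} (hU : IsOpen U) (hP : ContDiffOn ℝ 2 P U) {x : E} (hx : x ∈ U) :
    HasFDerivAt P (fderiv ℝ P x) x ∧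
    HasFDerivAt (fderiv ℝ P) (fderiv ℝ (fderiv ℝ P) x) x := by
  have h := hP.contDiffAt (hU.mem_nhds hx)
  constructor
  · exact (h.differentiableAt (by norm_num)).hasFDerivAt
  · have h2 : ContDiffAt ℝ 1 (fderiv ℝ P) x := h.fderiv_right (by norm_num)
    exact (h2.differentiableAt (by norm_num)).hasFDerivAt

lemma edge_mono {P : E → ℝ} {U : Set E} (hU : IsOpen U) (hP : ContDiffOn ℝ 2 P U) (a b : E) (μ : ℝ)
    (hseg : ∀ s ∈ Set.Icc (0:ℝ) 1, a + s • (b - a) ∈ U)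
    (hh : ∀ s ∈ Set.Icc (0:ℝ) 1, μ ≤ hess P (a + s • (b - a)) (b - a)) :
    μ ≤ (fderiv ℝ P b - fderiv ℝ P a) (b - a) := by
  have hd : ∀ s ∈ Set.Icc (0:ℝ) 1, HasDerivAt (fun s : ℝ => fderiv ℝ P (a + s • (b - a)) (b - a))
      (hess P (a + s • (b - a)) (b - a)) s := by
    intro s hs
    have h1 := (c2_fderiv hU hP (hseg s hs)).2
    have h2 : HasDerivAt (fun s : ℝ => a + s • (b - a)) (b - a) s := by
      simpa using ((hasDerivAt_id s).smul_const (b - a)).const_add a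
    have h3 := h1.comp_hasDerivAt s h2
    have := (ContinuousLinearMap.apply ℝ ℝ (b - a)).hasFDerivAt.comp_hasDerivAt s h3
    exact this
  have key := Convex.mul_sub_le_image_sub_of_le_deriv (D := Set.Icc (0:ℝ) 1) (convex_Icc 0 1)
    (f := fun s : ℝ => fderiv ℝ P (a + s • (b - a)) (b - a))
    (fun s hs => (hd s hs).continuousAt.continuousWithinAt)
    (fun s hs => (hd s (interior_subset hs)).differentiableAt.differentiableWithinAt)
    (C := μ) (fun s hs => by rw [(hd s (interior_subset hs)).deriv]; exact hh s (interior_subset hs))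
    0 (by simp) 1 (by simp) (by norm_num)
  simpa using key

variable {P : E → ℝ} {U : Set E}

lemma flow_phi_deriv (hU : IsOpen U) (hP : ContDiffOn ℝ 2 P U) (x0 : (Fin n → Bool) → E) (t : ℝ)
    (hm : ∀ ε, flow x0 (psym t) ε ∈ U) :
    HasDerivAt (fun t => ∑ ε, P (flow x0 (psym t) ε))
      (∑ ε, fderiv ℝ P (flow x0 (psym t) ε) (flow x0 (psym1 t) ε)) t := by
  apply HasDerivAt.fun_sum
  intro ε _
  exact (c2_fderiv hU hP (hm ε)).1.comp_hasDerivAt t (flow_deriv x0 t ε)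

lemma flow_phi_deriv2 (hU : IsOpen U) (hP : ContDiffOn ℝ 2 P U) (x0 : (Fin n → Bool) → E) (t : ℝ)
    (hm : ∀ ε, flow x0 (psym t) ε ∈ U) :
    HasDerivAt (fun t => ∑ ε, fderiv ℝ P (flow x0 (psym t) ε) (flow x0 (psym1 t) ε))
      (∑ ε, hess P (flow x0 (psym t) ε) (flow x0 (psym1 t) ε)
        + ∑ ε, ∑ i, (4:ℝ)⁻¹ * (fderiv ℝ P (flow x0 (psym t) ε)
            - fderiv ℝ P (flow x0 (psym t) (flipCoord i ε)))
              (flow x0 (psym t) ε - flow x0 (psym t) (flipCoord i ε))) t := by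
  have h1 : HasDerivAt (fun t => ∑ ε, fderiv ℝ P (flow x0 (psym t) ε) (flow x0 (psym1 t) ε))
      (∑ ε, (hess P (flow x0 (psym t) ε) (flow x0 (psym1 t) ε)
        + fderiv ℝ P (flow x0 (psym t) ε) (flow x0 (psym2 t) ε))) t := by
    apply HasDerivAt.fun_sum
    intro ε _
    have h3 := (c2_fderiv hU hP (hm ε)).2.comp_hasDerivAt t (flow_deriv x0 t ε)
    exact h3.clm_apply (flow1_deriv x0 t ε)
  refine h1.congr_deriv ?_
  rw [Finset.sum_add_distrib]
  congr 1
  simp only [flow_lap, map_sum, map_smul]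
  rw [Finset.sum_comm]
  conv_rhs => rw [Finset.sum_comm]
  apply Finset.sum_congr rfl
  intro i _
  set X := flow x0 (psym t)
  have e := csum_flip i (fun ε => (fderiv ℝ P (X ε)) (X ε - X (flipCoord i ε)))
  simp only [cflip_flip] at e
  have e2 : ∀ ε, (fderiv ℝ P (X (flipCoord i ε))) (X (flipCoord i ε) - X ε)
    = - (fderiv ℝ P (X (flipCoord i ε))) (X ε - X (flipCoord i ε)) := by
    intro ε; rw [← map_neg]; simp
  simp only [e2] at e
  rw [Finset.sum_neg_distrib] at e
  simp only [sub_apply, smul_eq_mul, ← Finset.mul_sum, Finset.sum_sub_distrib]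
  linarith
end

lemma convex_end (Φ Φ1 Φ2 : ℝ → ℝ) (c : ℝ) (h1 : ∀ t, 0 ≤ t → HasDerivAt Φ (Φ1 t) t)
    (h2 : ∀ t, 0 ≤ t → HasDerivAt Φ1 (Φ2 t) t) (h3 : ∀ t, 0 ≤ t → 0 ≤ Φ2 t)
    (hl : Filter.Tendsto Φ Filter.atTop (nhds c)) : c ≤ Φ 0 := by
  have hmono : MonotoneOn Φ1 (Set.Ici 0) := by
    apply monotoneOn_of_deriv_nonneg (convex_Ici 0)
    · exact fun t ht => (h2 t ht).continuousAt.continuousWithinAt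
    · exact fun t ht => (h2 t (interior_subset ht)).differentiableAt.differentiableWithinAt
    · intro t ht
      rw [(h2 t (interior_subset ht)).deriv]; exact h3 t (interior_subset ht)
  have hneg : ∀ t, 0 ≤ t → Φ1 t ≤ 0 := by
    intro t0 ht0
    by_contra hpos
    push Not at hpos
    have hlow : ∀ t, t0 ≤ t → Φ1 t0 * (t - t0) + Φ t0 ≤ Φ t := by
      intro t ht
      have := Convex.mul_sub_le_image_sub_of_le_deriv (D := Set.Ici t0) (convex_Ici t0)
        (f := Φ) (fun s hs => (h1 s (ht0.trans hs)).continuousAt.continuousWithinAt)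
        (fun s hs => (h1 s (ht0.trans (interior_subset hs))).differentiableAt.differentiableWithinAt)
        (C := Φ1 t0) (fun s hs => by
          have hs' : t0 ≤ s := interior_subset hs
          rw [(h1 s (ht0.trans hs')).deriv]
          exact hmono ht0 (ht0.trans hs') hs')
        t0 (Set.mem_Ici.mpr le_rfl) t ht ht
      linarith
    have hT : Filter.Tendsto (fun t => Φ1 t0 * (t - t0) + Φ t0) Filter.atTop Filter.atTop := by
      apply Filter.tendsto_atTop_add_const_right
      apply Filter.Tendsto.const_mul_atTop hpos
      exact Filter.tendsto_atTop_add_const_right _ _ Filter.tendsto_id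
    have hT2 : Filter.Tendsto Φ Filter.atTop Filter.atTop :=
      Filter.tendsto_atTop_mono' _ (Filter.eventually_atTop.mpr ⟨t0, hlow⟩) hT
    exact not_tendsto_nhds_of_tendsto_atTop hT2 c hl
  have hanti : AntitoneOn Φ (Set.Ici 0) := by
    apply antitoneOn_of_deriv_nonpos (convex_Ici 0)
    · exact fun t ht => (h1 t ht).continuousAt.continuousWithinAt
    · exact fun t ht => (h1 t (interior_subset ht)).differentiableAt.differentiableWithinAt
    · intro t ht
      rw [(h1 t (interior_subset ht)).deriv]; exact hneg t (interior_subset ht)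
  refine le_of_tendsto hl (Filter.eventually_atTop.mpr ⟨0, fun t ht => ?_⟩)
  exact hanti (Set.mem_Ici.mpr le_rfl) ht ht
end

noncomputable section

/-- Second order jet at zero. -/
def HasD2 (f : ℝ → ℝ) (a b c : ℝ) : Prop :=
  f 0 = a ∧ ∃ f1 : ℝ → ℝ, f1 0 = b ∧ (∀ᶠ s in nhds 0, HasDerivAt f (f1 s) s) ∧ HasDerivAt f1 c 0

/-- Logarithmic second order jet. -/
def HL (f : ℝ → ℝ) (a b c : ℝ) : Prop := HasD2 f a (a * b) (a * c)

lemma HasD2.cast {f : ℝ → ℝ} {a b c a' b' c' : ℝ} (h : HasD2 f a b c) (ha : a = a') (hb : b = b') (hc : c = c') :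
    HasD2 f a' b' c' := by subst ha hb hc; exact h

lemma HasD2.affine (x y : ℝ) : HasD2 (fun s => x + s * y) x y 0 := by
  refine ⟨by simp, fun _ => y, rfl, Filter.Eventually.of_forall fun s => ?_, hasDerivAt_const _ _⟩
  exact (((hasDerivAt_id s).mul_const y).const_add x).congr_deriv (by simp)

lemma HasD2.add {f g : ℝ → ℝ} {a b c a' b' c' : ℝ} (h : HasD2 f a b c) (h' : HasD2 g a' b' c') :
    HasD2 (fun s => f s + g s) (a + a') (b + b') (c + c') := by
  obtain ⟨h0, f1, h1, h2, h3⟩ := h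
  obtain ⟨k0, g1, k1, k2, k3⟩ := h'
  refine ⟨by simp [h0, k0], fun s => f1 s + g1 s, by simp [h1, k1], ?_, h3.add k3⟩
  filter_upwards [h2, k2] with s hs ks using hs.add ks

lemma HasD2.mul {f g : ℝ → ℝ} {a b c a' b' c' : ℝ} (h : HasD2 f a b c) (h' : HasD2 g a' b' c') :
    HasD2 (fun s => f s * g s) (a * a') (b * a' + a * b') (c * a' + 2 * b * b' + a * c') := by
  obtain ⟨h0, f1, h1, h2, h3⟩ := h
  obtain ⟨k0, g1, k1, k2, k3⟩ := h'
  refine ⟨by simp [h0, k0], fun s => f1 s * g s + f s * g1 s, by simp [h0, k0, h1, k1], ?_, ?_⟩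
  · filter_upwards [h2, k2] with s hs ks using hs.mul ks
  · refine ((h3.mul k2.self_of_nhds).add (h2.self_of_nhds.mul k3)).congr_deriv ?_
    rw [h0, h1, k0, k1]; ring

lemma HasD2.const (a : ℝ) : HasD2 (fun _ => a) a 0 0 :=
  ⟨rfl, fun _ => 0, rfl, Filter.Eventually.of_forall fun s => hasDerivAt_const _ _, hasDerivAt_const _ _⟩

lemma HasD2.const_mul {f : ℝ → ℝ} {a b c : ℝ} (A : ℝ) (h : HasD2 f a b c) :
    HasD2 (fun s => A * f s) (A * a) (A * b) (A * c) :=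
  ((HasD2.const A).mul h).cast rfl (by ring) (by ring)

lemma HasD2.sum {ι : Type*} (u : Finset ι) {f : ι → ℝ → ℝ} {a b c : ι → ℝ}
    (h : ∀ i ∈ u, HasD2 (f i) (a i) (b i) (c i)) :
    HasD2 (fun s => ∑ i ∈ u, f i s) (∑ i ∈ u, a i) (∑ i ∈ u, b i) (∑ i ∈ u, c i) := by
  classical
  induction u using Finset.induction_on with
  | empty => simpa using HasD2.const 0
  | insert i u hi ih =>
    simp only [Finset.sum_insert hi]
    exact (h i (by simp)).add (ih fun j hj => h j (by simp [hj]))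

lemma HasD2.rpow {f : ℝ → ℝ} {a b c : ℝ} (h : HasD2 f a b c) (ha : 0 < a) (r : ℝ) :
    HasD2 (fun s => f s ^ r) (a ^ r) (r * a ^ (r - 1) * b)
      (r * (r - 1) * a ^ (r - 2) * b ^ 2 + r * a ^ (r - 1) * c) := by
  obtain ⟨h0, f1, h1, h2, h3⟩ := h
  have hc : ContinuousAt f 0 := h2.self_of_nhds.continuousAt
  have hpos : ∀ᶠ s in nhds 0, 0 < f s := hc.eventually (lt_mem_nhds (by rw [h0]; exact ha))
  refine ⟨by simp [h0], fun s => f1 s * r * f s ^ (r - 1), by simp [h0, h1]; ring, ?_, ?_⟩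
  · filter_upwards [h2, hpos] with s hs ks using hs.rpow_const (Or.inl ks.ne')
  · have := (h3.mul_const r).mul (h2.self_of_nhds.rpow_const (p := r - 1) (Or.inl (by rw [h0]; exact ha.ne')))
    refine this.congr_deriv ?_
    rw [h0, h1, show r - 1 - 1 = r - 2 by ring]; ring

lemma HL.rpow {f : ℝ → ℝ} {a b c : ℝ} (h : HL f a b c) (ha : 0 < a) (r : ℝ) :
    HL (fun s => f s ^ r) (a ^ r) (r * b) (r * c + r * (r - 1) * b ^ 2) := by
  have e1 : a ^ (r - 1) * a = a ^ r := by rw [Real.rpow_sub_one ha.ne']; field_simp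
  have e2 : a ^ (r - 2) * a ^ 2 = a ^ r := by
    rw [← Real.rpow_natCast a 2, ← Real.rpow_add ha]; norm_num
  refine (HasD2.rpow h ha r).cast rfl ?_ ?_
  · rw [← e1]; ring
  · calc _ = r * (r - 1) * (a ^ (r - 2) * a ^ 2) * b ^ 2 + r * (a ^ (r - 1) * a) * c := by ring
      _ = _ := by rw [e1, e2]; ring

lemma HL.mul {f g : ℝ → ℝ} {a b c a' b' c' : ℝ} (h : HL f a b c) (h' : HL g a' b' c') :
    HL (fun s => f s * g s) (a * a') (b + b') (c + 2 * b * b' + c') :=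
  (HasD2.mul h h').cast rfl (by ring) (by ring)

lemma HL.affine (x y : ℝ) (hx : 0 < x) : HL (fun s => x + s * y) x (y / x) 0 :=
  (HasD2.affine x y).cast rfl (by field_simp) (by simp)

lemma hess_eq {E : Type*} [NormedAddCommGroup E] [NormedSpace ℝ E] {P : E → ℝ} {U : Set E} (hU : IsOpen U)
    (hP : ContDiffOn ℝ 2 P U) {x : E} (hx : x ∈ U) (y : E) {a b c : ℝ}
    (h : HasD2 (fun s => P (x + s • y)) a b c) : hess P x y = c := by
  obtain ⟨-, f1, -, h2, h3⟩ := h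
  have hl : ∀ s : ℝ, HasDerivAt (fun s : ℝ => x + s • y) y s := by
    intro s
    simpa using ((hasDerivAt_id s).smul_const y).const_add x
  have hm : ∀ᶠ s : ℝ in nhds 0, x + s • y ∈ U := by
    have := (hl 0).continuousAt.eventually (hU.mem_nhds (by simpa using hx))
    exact this
  have h4 : ∀ᶠ s : ℝ in nhds 0, f1 s = fderiv ℝ P (x + s • y) y := by
    filter_upwards [h2, hm] with s hs ks
    exact hs.unique ((c2_fderiv hU hP ks).1.comp_hasDerivAt s (hl s))
  have h5 : HasDerivAt (fun s : ℝ => fderiv ℝ P (x + s • y) y) c 0 := h3.congr_of_eventuallyEq (by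
    filter_upwards [h4] with s hs using hs.symm)
  have hx0 : x + (0:ℝ) • y = x := by simp
  have h6 : HasDerivAt (fun s : ℝ => fderiv ℝ P (x + s • y) y) (hess P x y) 0 := by
    have hx' : x + (0:ℝ) • y ∈ U := by rw [hx0]; exact hx
    have h3 := (c2_fderiv hU hP hx').2.comp_hasDerivAt (0:ℝ) (hl 0)
    have := (ContinuousLinearMap.apply ℝ ℝ y).hasFDerivAt.comp_hasDerivAt (0:ℝ) h3
    rw [hx0] at this
    exact this
  exact h6.unique h5

/-- second derivative of `|V|^2 Z`, algebraic part -/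
lemma alg1 (b β η σ1 σ2 c0 c1 c2 Z S : ℝ) (hb0 : 0 ≤ b) (hb1 : b ≤ 1) (hβ0 : 0 ≤ β) (hβ1 : β ≤ 1)
    (hZ : 0 < Z) (hc0 : 0 ≤ c0) (hc2 : 0 ≤ c2) (hc : c1 ^ 2 ≤ c0 * c2) (hS : c0 * Z ≤ S) :
    c2 * Z - S * (10 * η ^ 2 + 10 * σ1 ^ 2 + |σ2|) ≤
      2 * c2 * Z + 4 * c1 * Z * (b * η + β * σ1) +
      c0 * Z * (b * (b - 1) * η ^ 2 + 2 * b * β * η * σ1 + β * σ2 + β * (β - 1) * σ1 ^ 2) := by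
  set z1 := b * η + β * σ1 with hz1
  have h1 : -(c2 + 4 * c0 * z1 ^ 2) ≤ 4 * c1 * z1 := by
    rcases hc2.eq_or_lt with h | h
    · have : c1 = 0 := by
        rw [← h] at hc; nlinarith
      rw [this, ← h]; nlinarith [mul_nonneg hc0 (sq_nonneg z1)]
    · have : 0 ≤ c2 * (c2 + 4 * c0 * z1 ^ 2 + 4 * c1 * z1) := by
        nlinarith [sq_nonneg (c2 + 2 * c1 * z1), mul_nonneg (sub_nonneg.2 hc) (sq_nonneg z1)]
      nlinarith [nonneg_of_mul_nonneg_right this h]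
  have hz : z1 ^ 2 ≤ 2 * η ^ 2 + 2 * σ1 ^ 2 := by
    have e1 : (b * η) ^ 2 ≤ η ^ 2 := by
      rw [mul_pow]; exact mul_le_of_le_one_left (sq_nonneg _) (by nlinarith)
    have e2 : (β * σ1) ^ 2 ≤ σ1 ^ 2 := by
      rw [mul_pow]; exact mul_le_of_le_one_left (sq_nonneg _) (by nlinarith)
    rw [hz1]; nlinarith [sq_nonneg (b * η - β * σ1)]
  have hz2 : -(2 * η ^ 2 + 2 * σ1 ^ 2 + |σ2|) ≤
      b * (b - 1) * η ^ 2 + 2 * b * β * η * σ1 + β * σ2 + β * (β - 1) * σ1 ^ 2 := by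
    have e1 : -η ^ 2 ≤ b * (b - 1) * η ^ 2 := by
      nlinarith [mul_nonneg (sq_nonneg η) (show 0 ≤ 1 + b * (b - 1) by nlinarith)]
    have e2 : -σ1 ^ 2 ≤ β * (β - 1) * σ1 ^ 2 := by
      nlinarith [mul_nonneg (sq_nonneg σ1) (show 0 ≤ 1 + β * (β - 1) by nlinarith)]
    have e3 : -|σ2| ≤ β * σ2 := by
      have := neg_abs_le σ2
      have := abs_nonneg σ2
      nlinarith [mul_le_mul_of_nonneg_left (neg_abs_le σ2) hβ0]
    have e4 : -(η ^ 2 + σ1 ^ 2) ≤ 2 * b * β * η * σ1 := by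
      have h0 : 0 ≤ b * β := mul_nonneg hb0 hβ0
      have h1 : b * β ≤ 1 := by nlinarith
      nlinarith [mul_nonneg h0 (sq_nonneg (η + σ1)), mul_nonneg (sub_nonneg.2 h1) (sq_nonneg η),
        mul_nonneg (sub_nonneg.2 h1) (sq_nonneg σ1)]
    linarith
  have hT : 0 ≤ 10 * η ^ 2 + 10 * σ1 ^ 2 + |σ2| := by positivity
  have h5 := mul_le_mul_of_nonneg_right hS hT
  have h6 := mul_le_mul_of_nonneg_left h1 hZ.le
  have hcZ : 0 ≤ c0 * Z := by positivity
  have h7 := mul_le_mul_of_nonneg_left hz hcZ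
  have h8 := mul_le_mul_of_nonneg_left hz2 hcZ
  nlinarith

/-- bounds for the log-derivatives of `S = M + N` -/
lemma alg2 (q e b' M N k η l : ℝ) (hq : 2 ≤ q) (he : 1 < e) (hb0 : 0 ≤ b') (hb1 : b' ≤ 1)
    (hM : 0 < M) (hN : 0 < N) :
    (M + N) * (10 * η ^ 2 + 10 * ((M * (q * k + b' * η) + N * (e * l)) / (M + N)) ^ 2
      + |(M * (q * (q - 1) * k ^ 2 + 2 * q * b' * k * η + b' * (b' - 1) * η ^ 2)
          + N * (e * (e - 1) * l ^ 2)) / (M + N)|)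
    ≤ 22 * q ^ 2 * M * k ^ 2 + 11 * e ^ 2 * N * l ^ 2 + 32 * (M + N) * η ^ 2 := by
  set m1 := q * k + b' * η with hm1
  set m2 := q * (q - 1) * k ^ 2 + 2 * q * b' * k * η + b' * (b' - 1) * η ^ 2 with hm2
  have hS : 0 < M + N := by positivity
  have hbη : (b' * η) ^ 2 ≤ η ^ 2 := by
    rw [mul_pow]; exact mul_le_of_le_one_left (sq_nonneg _) (by nlinarith)
  have a1 : m1 ^ 2 ≤ 2 * q ^ 2 * k ^ 2 + 2 * η ^ 2 := by
    rw [hm1]; nlinarith [sq_nonneg (q * k - b' * η)]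
  have a2 : |m2| ≤ 2 * q ^ 2 * k ^ 2 + 2 * η ^ 2 := by
    rw [hm2, abs_le]
    have : b' ^ 2 ≤ 1 := by nlinarith
    have h9 := mul_nonneg (sq_nonneg η) hb0
    have h10 := mul_nonneg (sq_nonneg η) (sub_nonneg.2 hb1)
    have h11 : 0 ≤ q * k ^ 2 := by positivity
    have h12 : 0 ≤ (q * (q - 1)) * k ^ 2 := mul_nonneg (by nlinarith) (sq_nonneg k)
    constructor
    · nlinarith [sq_nonneg (q * k + b' * η)]
    · nlinarith [sq_nonneg (q * k - b' * η)]
  have b1 : (M + N) * ((M * m1 + N * (e * l)) / (M + N)) ^ 2 ≤ M * m1 ^ 2 + N * (e * l) ^ 2 := by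
    rw [div_pow, ← mul_div_assoc, div_le_iff₀ (by positivity)]
    have : 0 ≤ M * N * (m1 - e * l) ^ 2 := by positivity
    nlinarith
  have b2 : (M + N) * |(M * m2 + N * (e * (e - 1) * l ^ 2)) / (M + N)| ≤ M * |m2| + N * (e ^ 2 * l ^ 2) := by
    rw [abs_div, abs_of_pos hS, mul_div_cancel₀ _ hS.ne']
    refine (abs_add_le _ _).trans ?_
    rw [abs_mul, abs_of_pos hM, abs_mul N, abs_of_pos hN]
    gcongr
    rw [abs_of_nonneg (by have : 0 ≤ e - 1 := by linarith
                          positivity)]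
    nlinarith [mul_nonneg (by linarith : 0 ≤ e) (sq_nonneg l)]
  nlinarith [mul_le_mul_of_nonneg_left a1 hM.le, mul_le_mul_of_nonneg_left a2 hM.le,
    mul_nonneg hN.le (sq_nonneg η)]

lemma alg3 (q e b' M N k η l : ℝ) (hq : 2 ≤ q) (hb0 : 0 ≤ b') (hb1 : b' ≤ 1)
    (hM : 0 < M) (hN : 0 < N) :
    M * k ^ 2 - (q ^ 2 + 1) * (M + N) * η ^ 2 + N * (e * (e - 1) * l ^ 2) ≤
    (M * (q * (q - 1) * k ^ 2 + 2 * q * b' * k * η + b' * (b' - 1) * η ^ 2)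
          + N * (e * (e - 1) * l ^ 2)) := by
  have hbη : (b' * η) ^ 2 ≤ η ^ 2 := by
    rw [mul_pow]; exact mul_le_of_le_one_left (sq_nonneg _) (by nlinarith)
  have h1 : k ^ 2 - (q ^ 2 + 1) * η ^ 2 ≤ q * (q - 1) * k ^ 2 + 2 * q * b' * k * η + b' * (b' - 1) * η ^ 2 := by
    have e1 : -η ^ 2 ≤ b' * (b' - 1) * η ^ 2 := by
      nlinarith [mul_nonneg (sq_nonneg η) (show 0 ≤ 1 + b' * (b' - 1) by nlinarith)]
    have e2 : 0 ≤ (q * (q - 1) - 2) * k ^ 2 := mul_nonneg (by nlinarith) (sq_nonneg k)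
    have e3 : q ^ 2 * (b' * η) ^ 2 ≤ q ^ 2 * η ^ 2 := by gcongr
    nlinarith [sq_nonneg (k + q * (b' * η))]
  have h2 : 0 ≤ (q ^ 2 + 1) * N * η ^ 2 := by positivity
  nlinarith [mul_le_mul_of_nonneg_left h1 hM.le]

/-- the G part -/
lemma alg4 (κ G G' r : ℝ) (h0 : 0 < κ) (h1 : κ < 1) :
    2 * (1 - κ) / (1 + κ) * G' ^ 2 ≤ 2 * G' ^ 2 - 4 * κ * G * G' * r + κ * (κ + 1) * (G * r) ^ 2 := by
  rw [div_mul_eq_mul_div, div_le_iff₀ (by linarith)]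
  nlinarith [mul_nonneg h0.le (sq_nonneg (2 * G' - (1 + κ) * (G * r)))]
end

noncomputable section

/-- exponents -/
structure Par where
  q : ℝ
  p : ℝ
  hq : 2 ≤ q
  hqp : q ≤ p

namespace Par
variable (c : Par)
def e : ℝ := c.p / (c.p - 1)
def κ : ℝ := (c.p - 1) / c.p
def β : ℝ := 1 - 2 / c.q
def b1 : ℝ := (c.p - c.q) / (c.p - 1)
def b : ℝ := 2 * c.b1 / c.q
def A1 : ℝ := 22 * c.q ^ 2 + 11 * c.e / (c.e - 1)
def C7 : ℝ := 32 + c.A1 * (c.q ^ 2 + 1)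
def A2 : ℝ := 2 * c.C7 / (c.e * (c.e - 1))
def cκ : ℝ := 2 * (1 - c.κ) / (1 + c.κ)
lemma hp : 2 ≤ c.p := c.hq.trans c.hqp
lemma p1 : 0 < c.p - 1 := by linarith [c.hp]
lemma p0 : 0 < c.p := by linarith [c.hp]
lemma q0 : 0 < c.q := by linarith [c.hq]
lemma e1 : 1 < c.e := by
  unfold e; rw [lt_div_iff₀ c.p1]; linarith
lemma κ0 : 0 < c.κ := div_pos c.p1 c.p0
lemma κ1 : c.κ < 1 := by
  unfold κ; rw [div_lt_one c.p0]; linarith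
lemma eκ : c.e * c.κ = 1 := by
  have := c.p1.ne'; have := c.p0.ne'
  unfold e κ; field_simp
lemma β0 : 0 ≤ c.β := by
  unfold β; rw [sub_nonneg, div_le_one c.q0]; exact c.hq
lemma β1 : c.β ≤ 1 := by
  unfold β; have : 0 ≤ 2 / c.q := by have := c.q0; positivity
  linarith
lemma b10 : 0 ≤ c.b1 := div_nonneg (by linarith [c.hqp]) c.p1.le
lemma b11 : c.b1 ≤ 1 := by
  unfold b1; rw [div_le_one c.p1]; linarith [c.hq]
lemma bnn : 0 ≤ c.b := by
  unfold b; exact div_nonneg (by linarith [c.b10]) c.q0.le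
lemma ble : c.b ≤ 1 := by
  unfold b; rw [div_le_one c.q0]; linarith [c.b11, c.hq]
lemma ab : c.β * c.e + c.b = (c.p - 2) / (c.p - 1) := by
  have := c.p1.ne'; have := c.q0.ne'
  unfold β e b b1; field_simp; ring
lemma ab_le : c.β * c.e ^ 2 + c.b * c.e ≤ 1 := by
  have h : c.β * c.e ^ 2 + c.b * c.e = (c.p - 2) / (c.p - 1) * c.e := by rw [← c.ab]; ring
  rw [h]; unfold e
  have := c.p1
  rw [div_mul_div_comm, div_le_one (by positivity)]; nlinarith
lemma A1nn : 0 ≤ c.A1 := by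
  unfold A1; have := c.e1; have : 0 < c.e - 1 := by linarith
  positivity
lemma A1l : 11 * c.e ^ 2 ≤ c.A1 * (c.e * (c.e - 1)) := by
  unfold A1; have h := c.e1; have h' : 0 < c.e - 1 := by linarith
  have e1 : 11 * c.e / (c.e - 1) * (c.e * (c.e - 1)) = 11 * c.e ^ 2 := by field_simp
  have : 0 ≤ 22 * c.q ^ 2 * (c.e * (c.e - 1)) := by positivity
  nlinarith
lemma A1k : 22 * c.q ^ 2 ≤ c.A1 := by
  unfold A1; have h := c.e1; have h' : 0 < c.e - 1 := by linarith
  have : 0 ≤ 11 * c.e / (c.e - 1) := by positivity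
  linarith
lemma C7nn : 0 ≤ c.C7 := by unfold C7; have := c.A1nn; positivity
lemma A2nn : 0 ≤ c.A2 := by
  unfold A2; have := c.C7nn; have h := c.e1; have h' : 0 < c.e - 1 := by linarith
  positivity
lemma A2e : c.A2 * (c.e * (c.e - 1)) = 2 * c.C7 := by
  unfold A2; have h := c.e1; have h' : 0 < c.e - 1 := by linarith
  field_simp
lemma cκ0 : 0 < c.cκ := by
  unfold cκ; have := c.κ0; have := c.κ1
  have : 0 < 1 - c.κ := by linarith
  positivity

def S (K L H : ℝ) : ℝ := K ^ c.q * H ^ c.b1 + L ^ c.e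

def term {n : ℕ} (V : Fin n → ℝ) (G K L R H : ℝ) : ℝ :=
  (∑ i, V i ^ 2) * (H ^ c.b * c.S K L H ^ c.β) + c.A1 * c.S K L H + G ^ 2 * R ^ (-c.κ)

lemma S_pos {K L H : ℝ} (hK : 0 < K) (hL : 0 < L) (hH : 0 < H) : 0 < c.S K L H := by
  unfold S; positivity

/-- `K^2 H^b S^β ≤ S` -/
lemma KZ_le {K L H : ℝ} (hK : 0 < K) (hL : 0 < L) (hH : 0 < H) :
    K ^ 2 * (H ^ c.b * c.S K L H ^ c.β) ≤ c.S K L H := by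
  have hq := c.q0
  have hM : 0 < K ^ c.q * H ^ c.b1 := by positivity
  have h1 : K ^ 2 * H ^ c.b = (K ^ c.q * H ^ c.b1) ^ (2 / c.q) := by
    rw [Real.mul_rpow (by positivity) (by positivity), ← Real.rpow_mul hK.le, ← Real.rpow_mul hH.le,
      mul_div_cancel₀ _ hq.ne']
    unfold b
    norm_num
    left; congr 1; ring
  have hS := c.S_pos hK hL hH
  have h2 : (K ^ c.q * H ^ c.b1) ^ (2 / c.q) ≤ c.S K L H ^ (2 / c.q) := by
    apply Real.rpow_le_rpow hM.le _ (by positivity)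
    unfold S; have : 0 < L ^ c.e := by positivity
    linarith
  calc _ = (K ^ 2 * H ^ c.b) * c.S K L H ^ c.β := by ring
    _ ≤ c.S K L H ^ (2 / c.q) * c.S K L H ^ c.β := by rw [h1]; gcongr
    _ = c.S K L H := by
      rw [← Real.rpow_add hS]; unfold β; norm_num

lemma R_le {K L R H : ℝ} (hK : 0 < K) (hL : 0 < L) (hR : 0 < R) (hH : 0 < H)
    (h : R ≤ L ^ (c.β * c.e ^ 2) * H ^ (c.b * c.e)) : R ^ c.κ ≤ H ^ c.b * c.S K L H ^ c.β := by
  have hk := c.κ0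
  have ek := c.eκ
  have h1 : R ^ c.κ ≤ (L ^ (c.β * c.e ^ 2) * H ^ (c.b * c.e)) ^ c.κ := Real.rpow_le_rpow hR.le h hk.le
  have h2 : (L ^ (c.β * c.e ^ 2) * H ^ (c.b * c.e)) ^ c.κ = H ^ c.b * (L ^ c.e) ^ c.β := by
    rw [Real.mul_rpow (by positivity) (by positivity), ← Real.rpow_mul hL.le, ← Real.rpow_mul hH.le,
      ← Real.rpow_mul hL.le, mul_comm]
    congr 2
    · rw [mul_assoc, ek, mul_one]
    · calc _ = c.β * c.e * (c.e * c.κ) := by ring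
        _ = _ := by rw [ek]; ring
  rw [h2] at h1
  refine h1.trans ?_
  gcongr
  · exact c.β0
  · unfold S; have : 0 < K ^ c.q * H ^ c.b1 := by positivity
    linarith

lemma term_jet {n : ℕ} (V V' : Fin n → ℝ) (G G' K K' L L' R R' H H' : ℝ)
    (hK : 0 < K) (hL : 0 < L) (hR : 0 < R) (hH : 0 < H) (hV : ∑ i, V i ^ 2 ≤ K ^ 2)
    (h : R ≤ L ^ (c.β * c.e ^ 2) * H ^ (c.b * c.e)) :
    ∃ x y z, HasD2 (fun s => c.term (fun i => V i + s * V' i) (G + s * G') (K + s * K') (L + s * L')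
      (R + s * R') (H + s * H')) x y z ∧
      R ^ c.κ * ∑ i, V' i ^ 2 + c.cκ * (R ^ (-c.κ) * G' ^ 2) - c.C7 * c.S K L H * (H' / H) ^ 2 ≤ z := by
  have hS := c.S_pos hK hL hH
  have jH := HL.affine H H' hH
  have jK := HL.affine K K' hK
  have jL := HL.affine L L' hL
  have jR := HL.affine R R' hR
  have jM := (jK.rpow hK c.q).mul (jH.rpow hH c.b1)
  have jN := jL.rpow hL c.e
  have jS := HasD2.add jM jN
  have jS' : HL (fun s => c.S (K + s * K') (L + s * L') (H + s * H')) (c.S K L H) _ _ :=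
    jS.cast rfl (mul_div_cancel₀ _ hS.ne').symm (mul_div_cancel₀ _ hS.ne').symm
  have jZ := (jH.rpow hH c.b).mul (jS'.rpow hS c.β)
  have jv : HasD2 (fun s => ∑ i, (V i + s * V' i) ^ 2) (∑ i, V i ^ 2) (2 * ∑ i, V i * V' i)
      (2 * ∑ i, V' i ^ 2) := by
    simp only [sq]
    refine (HasD2.sum Finset.univ (fun i _ => (HasD2.affine (V i) (V' i)).mul (HasD2.affine (V i) (V' i)))).cast
      rfl ?_ ?_
    · rw [Finset.mul_sum]; exact Finset.sum_congr rfl fun i _ => by ring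
    · rw [Finset.mul_sum]; exact Finset.sum_congr rfl fun i _ => by ring
  have jG : HasD2 (fun s => (G + s * G') ^ 2) (G ^ 2) (2 * (G * G')) (2 * G' ^ 2) := by
    simp only [sq]
    exact ((HasD2.affine G G').mul (HasD2.affine G G')).cast rfl (by ring) (by ring)
  have jGR := jG.mul (jR.rpow hR (-c.κ))
  have J := ((jv.mul jZ).add (jS.const_mul c.A1)).add jGR
  refine ⟨_, _, _, J, ?_⟩
  have hM : 0 < K ^ c.q * H ^ c.b1 := by positivity
  have hN : 0 < L ^ c.e := by positivity
  have hSd : K ^ c.q * H ^ c.b1 + L ^ c.e = c.S K L H := rfl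
  set c0 := ∑ i, V i ^ 2
  set c1 := ∑ i, V i * V' i
  set c2 := ∑ i, V' i ^ 2
  have hZ : 0 < H ^ c.b * c.S K L H ^ c.β := by positivity
  have hc0 : 0 ≤ c0 := Finset.sum_nonneg fun i _ => sq_nonneg _
  have hc2 : 0 ≤ c2 := Finset.sum_nonneg fun i _ => sq_nonneg _
  have hc : c1 ^ 2 ≤ c0 * c2 := Finset.sum_mul_sq_le_sq_mul_sq _ _ _
  have hcZ : c0 * (H ^ c.b * c.S K L H ^ c.β) ≤ c.S K L H :=
    (mul_le_mul_of_nonneg_right hV hZ.le).trans (c.KZ_le hK hL hH)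
  have hRZ := c.R_le hK hL hR hH h
  set k := K' / K
  set η := H' / H
  set l := L' / L
  set r := R' / R
  set Z := H ^ c.b * c.S K L H ^ c.β
  set M := K ^ c.q * H ^ c.b1
  set N := L ^ c.e
  have B2 := alg2 c.q c.e c.b1 M N k η l c.hq c.e1 c.b10 c.b11 hM hN
  have B3 := alg3 c.q c.e c.b1 M N k η l c.hq c.b10 c.b11 hM hN
  have B4 := alg4 c.κ G G' r c.κ0 c.κ1
  set σ1 := (M * (c.q * k + c.b1 * η) + N * (c.e * l)) / (M + N) with hσ1
  set m2 := c.q * (c.q - 1) * k ^ 2 + 2 * c.q * c.b1 * k * η + c.b1 * (c.b1 - 1) * η ^ 2 with hm2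
  set σ2 := (M * m2 + N * (c.e * (c.e - 1) * l ^ 2)) / (M + N) with hσ2
  have B1 := alg1 c.b c.β η σ1 σ2 c0 c1 c2 Z (M + N) c.bnn c.ble c.β0 c.β1 hZ hc0 hc2 hc hcZ
  have hRk : 0 < R ^ (-c.κ) := by positivity
  have B4' := mul_le_mul_of_nonneg_left B4 hRk.le
  have B5 := mul_le_mul_of_nonneg_right hRZ hc2
  have B6 := mul_le_mul_of_nonneg_left B3 c.A1nn
  have B7 := mul_le_mul_of_nonneg_right c.A1l (show 0 ≤ N * l ^ 2 by positivity)
  have B8 := mul_le_mul_of_nonneg_right c.A1k (show 0 ≤ M * k ^ 2 by positivity)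
  rw [← hSd]
  have e1 : c.q * 0 + c.q * (c.q - 1) * k ^ 2 + 2 * (c.q * k) * (c.b1 * η) + (c.b1 * 0 + c.b1 * (c.b1 - 1) * η ^ 2) = m2 := by
    rw [hm2]; ring
  rw [e1]
  have e2 : c.e * 0 + c.e * (c.e - 1) * l ^ 2 = c.e * (c.e - 1) * l ^ 2 := by ring
  rw [e2, ← hσ1, ← hσ2]
  change c.cκ * _ ≤ _ at B4
  have e3 : c.C7 = 32 + c.A1 * (c.q ^ 2 + 1) := rfl
  rw [e3]
  change R ^ (-c.κ) * (c.cκ * G' ^ 2) ≤ _ at B4'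
  ring_nf at B1 B2 B4' B5 B6 B7 B8 ⊢
  linarith
end Par
end

noncomputable section

/-- state space -/
abbrev St (n : ℕ) (Ω : Type) :=
  (Fin n → Ω → ℝ) × (Ω → ℝ) × (Ω → ℝ) × (Ω → ℝ) × (Ω → ℝ) × ℝ

namespace St
variable {n : ℕ} {Ω : Type}
abbrev V (x : St n Ω) : Fin n → Ω → ℝ := x.1
abbrev G (x : St n Ω) : Ω → ℝ := x.2.1
abbrev K (x : St n Ω) : Ω → ℝ := x.2.2.1
abbrev L (x : St n Ω) : Ω → ℝ := x.2.2.2.1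
abbrev R (x : St n Ω) : Ω → ℝ := x.2.2.2.2.1
abbrev H (x : St n Ω) : ℝ := x.2.2.2.2.2
end St

/-- concavity of the monomial -/
lemma mono_concave (a b : ℝ) (ha : 0 ≤ a) (hb : 0 ≤ b) (hab : a + b ≤ 1)
    (x1 y1 x2 y2 s t : ℝ) (hx1 : 0 < x1) (hy1 : 0 < y1) (hx2 : 0 < x2) (hy2 : 0 < y2)
    (hs : 0 ≤ s) (ht : 0 ≤ t) (hst : s + t = 1) :
    s * (x1 ^ a * y1 ^ b) + t * (x2 ^ a * y2 ^ b) ≤ (s * x1 + t * x2) ^ a * (s * y1 + t * y2) ^ b := by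
  set X := s * x1 + t * x2 with hX
  set Y := s * y1 + t * y2 with hY
  have hXp : 0 < X := by
    rcases hs.eq_or_lt with h | h
    · have : t = 1 := by linarith
      rw [hX, ← h, this]; simpa using hx2
    · have : 0 ≤ t * x2 := by positivity
      have : 0 < s * x1 := by positivity
      linarith
  have hYp : 0 < Y := by
    rcases hs.eq_or_lt with h | h
    · have : t = 1 := by linarith
      rw [hY, ← h, this]; simpa using hy2
    · have : 0 ≤ t * y2 := by positivity
      have : 0 < s * y1 := by positivity
      linarith
  have key : ∀ x y : ℝ, 0 < x → 0 < y → x ^ a * y ^ b ≤ X ^ a * Y ^ b * (a * (x / X) + b * (y / Y) + (1 - a - b)) := by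
    intro x y hx hy
    have := Real.geom_mean_le_arith_mean3_weighted ha hb (show 0 ≤ 1 - a - b by linarith)
      (show 0 ≤ x / X by positivity) (show 0 ≤ y / Y by positivity) zero_le_one (by ring)
    rw [Real.one_rpow, mul_one, mul_one, Real.div_rpow hx.le hXp.le, Real.div_rpow hy.le hYp.le,
      div_mul_div_comm, div_le_iff₀ (by positivity)] at this
    linarith
  have k1 := mul_le_mul_of_nonneg_left (key x1 y1 hx1 hy1) hs
  have k2 := mul_le_mul_of_nonneg_left (key x2 y2 hx2 hy2) ht
  have e1 : s * (x1 / X) + t * (x2 / X) = 1 := by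
    rw [← mul_div_assoc, ← mul_div_assoc, ← add_div, ← hX, div_self hXp.ne']
  have e2 : s * (y1 / Y) + t * (y2 / Y) = 1 := by
    rw [← mul_div_assoc, ← mul_div_assoc, ← add_div, ← hY, div_self hYp.ne']
  calc _ ≤ X ^ a * Y ^ b * (a * (s * (x1 / X) + t * (x2 / X)) + b * (s * (y1 / Y) + t * (y2 / Y)) + (1 - a - b) * (s + t)) := by
        linarith
    _ = _ := by rw [e1, e2, hst]; ring

lemma lp_convex {Ω : Type} [Fintype Ω] (r : ℝ) (hr : 1 ≤ r) (x y : Ω → ℝ) (hx : ∀ ω, 0 ≤ x ω) (hy : ∀ ω, 0 ≤ y ω)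
    (s t : ℝ) (hs : 0 ≤ s) (ht : 0 ≤ t) :
    (∑ ω, (s * x ω + t * y ω) ^ r) ^ (1 / r) ≤ s * (∑ ω, x ω ^ r) ^ (1 / r) + t * (∑ ω, y ω ^ r) ^ (1 / r) := by
  have h := Real.Lp_add_le_of_nonneg Finset.univ (f := fun ω => s * x ω) (g := fun ω => t * y ω) hr
    (fun ω _ => mul_nonneg hs (hx ω)) (fun ω _ => mul_nonneg ht (hy ω))
  have e : ∀ (s : ℝ) (x : Ω → ℝ), 0 ≤ s → (∀ ω, 0 ≤ x ω) →
      (∑ ω, (s * x ω) ^ r) ^ (1 / r) = s * (∑ ω, x ω ^ r) ^ (1 / r) := by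
    intro s x hs hx
    have : ∀ ω, (s * x ω) ^ r = s ^ r * x ω ^ r := fun ω => Real.mul_rpow hs (hx ω)
    simp only [this, ← Finset.mul_sum]
    rw [Real.mul_rpow (by positivity) (Finset.sum_nonneg fun ω _ => Real.rpow_nonneg (hx ω) _),
      ← Real.rpow_mul hs, mul_one_div_cancel (by linarith), Real.rpow_one]
  rwa [e s x hs hx, e t y ht hy] at h

namespace Par
variable (c : Par) {n : ℕ} {Ω : Type}

def U (n : ℕ) (Ω : Type) : Set (St n Ω) :=
  {x | (∀ ω, 0 < x.K ω) ∧ (∀ ω, 0 < x.L ω) ∧ (∀ ω, 0 < x.R ω) ∧ 0 < x.H}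

variable [Fintype Ω]

def D (n : ℕ) (Ω : Type) [Fintype Ω] : Set (St n Ω) :=
  {x | x ∈ U n Ω ∧ (∀ ω, ∑ i, x.V i ω ^ 2 ≤ x.K ω ^ 2)
    ∧ (∑ ω, x.K ω ^ c.q) ^ (1 / c.q) ≤ x.H ^ (1 / (c.p - 1))
    ∧ (∑ ω, x.L ω ^ c.e) ^ (1 / c.e) ≤ x.H
    ∧ ∀ ω, x.R ω ≤ x.L ω ^ (c.β * c.e ^ 2) * x.H ^ (c.b * c.e)}

def B (x : St n Ω) : ℝ :=
  (∑ ω, c.term (fun i => x.V i ω) (x.G ω) (x.K ω) (x.L ω) (x.R ω) x.H) + c.A2 * x.H ^ c.e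

lemma U_open [Finite Ω] : IsOpen (U n Ω) := by
  unfold U
  simp only [Set.ofPred_and, Set.ofPred_forall]
  refine IsOpen.inter (isOpen_iInter_of_finite fun ω => ?_) (IsOpen.inter (isOpen_iInter_of_finite fun ω => ?_)
    (IsOpen.inter (isOpen_iInter_of_finite fun ω => ?_) ?_))
  all_goals exact isOpen_lt continuous_const (by fun_prop)

lemma B_contDiff : ContDiffOn ℝ 2 (c.B : St n Ω → ℝ) (U n Ω) := by
  have hH : ContDiffOn ℝ 2 (fun x : St n Ω => x.H) (U n Ω) := by fun_prop
  have hHr : ∀ r : ℝ, ContDiffOn ℝ 2 (fun x : St n Ω => x.H ^ r) (U n Ω) := fun r =>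
    hH.rpow_const_of_ne fun x hx => hx.2.2.2.ne'
  have hK : ∀ ω, ContDiffOn ℝ 2 (fun x : St n Ω => x.K ω ^ c.q) (U n Ω) := fun ω =>
    ContDiffOn.rpow_const_of_ne (by fun_prop) fun x hx => (hx.1 ω).ne'
  have hL : ∀ ω, ContDiffOn ℝ 2 (fun x : St n Ω => x.L ω ^ c.e) (U n Ω) := fun ω =>
    ContDiffOn.rpow_const_of_ne (by fun_prop) fun x hx => (hx.2.1 ω).ne'
  have hR : ∀ ω, ContDiffOn ℝ 2 (fun x : St n Ω => x.R ω ^ (-c.κ)) (U n Ω) := fun ω =>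
    ContDiffOn.rpow_const_of_ne (by fun_prop) fun x hx => (hx.2.2.1 ω).ne'
  have hS : ∀ ω, ContDiffOn ℝ 2 (fun x : St n Ω => c.S (x.K ω) (x.L ω) x.H) (U n Ω) := fun ω =>
    ((hK ω).mul (hHr _)).add (hL ω)
  have hSβ : ∀ ω, ContDiffOn ℝ 2 (fun x : St n Ω => c.S (x.K ω) (x.L ω) x.H ^ c.β) (U n Ω) := fun ω =>
    (hS ω).rpow_const_of_ne fun x hx => (c.S_pos (hx.1 ω) (hx.2.1 ω) hx.2.2.2).ne'
  unfold B term
  refine ContDiffOn.add (ContDiffOn.sum fun ω _ => ?_) (contDiffOn_const.mul (hHr _))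
  refine ContDiffOn.add (ContDiffOn.add (ContDiffOn.mul ?_ ((hHr _).mul (hSβ ω))) (contDiffOn_const.mul (hS ω)))
    (ContDiffOn.mul ?_ (hR ω))
  · exact ContDiffOn.sum fun i _ => by fun_prop
  · fun_prop

lemma B_nonneg {x : St n Ω} (hx : x ∈ U n Ω) : 0 ≤ c.B x := by
  have hH := hx.2.2.2
  have := c.A1nn
  have := c.A2nn
  unfold B term
  refine add_nonneg (Finset.sum_nonneg fun ω _ => ?_) (by positivity)
  have := c.S_pos (hx.1 ω) (hx.2.1 ω) hH
  have := hx.2.2.1 ω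
  positivity

lemma U_convex : Convex ℝ (U n Ω) := by
  have pos : ∀ x y s t : ℝ, 0 < x → 0 < y → 0 ≤ s → 0 ≤ t → s + t = 1 → 0 < s * x + t * y := by
    intro x y s t hx hy hs ht hst
    rcases hs.eq_or_lt with h | h
    · have : t = 1 := by linarith
      rw [← h, this]; simpa using hy
    · have : 0 ≤ t * y := by positivity
      have : 0 < s * x := by positivity
      linarith
  intro x hx y hy s t hs ht hst
  exact ⟨fun ω => pos _ _ s t (hx.1 ω) (hy.1 ω) hs ht hst, fun ω => pos _ _ s t (hx.2.1 ω) (hy.2.1 ω) hs ht hst,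
    fun ω => pos _ _ s t (hx.2.2.1 ω) (hy.2.2.1 ω) hs ht hst, pos _ _ s t hx.2.2.2 hy.2.2.2 hs ht hst⟩

lemma D_convex : Convex ℝ (c.D n Ω) := by
  intro x hx y hy s t hs ht hst
  have hU := U_convex hx.1 hy.1 hs ht hst
  obtain ⟨⟨xK, xL, xR, xH⟩, x1, x2, x3, x4⟩ := hx
  obtain ⟨⟨yK, yL, yR, yH⟩, y1, y2, y3, y4⟩ := hy
  refine ⟨hU, fun ω => ?_, ?_, ?_, fun ω => ?_⟩
  · change ∑ i, (s * x.V i ω + t * y.V i ω) ^ 2 ≤ (s * x.K ω + t * y.K ω) ^ 2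
    have h1 := x1 ω
    have h2 := y1 ω
    have hc : (∑ i, x.V i ω * y.V i ω) ^ 2 ≤ (x.K ω * y.K ω) ^ 2 := by
      refine (Finset.sum_mul_sq_le_sq_mul_sq _ _ _).trans ?_
      rw [mul_pow]
      exact mul_le_mul h1 h2 (Finset.sum_nonneg fun i _ => sq_nonneg _) (sq_nonneg _)
    have hc' := abs_le_of_sq_le_sq' hc (mul_nonneg (xK ω).le (yK ω).le)
    have e : ∑ i, (s * x.V i ω + t * y.V i ω) ^ 2 = s ^ 2 * ∑ i, x.V i ω ^ 2
        + 2 * s * t * ∑ i, x.V i ω * y.V i ω + t ^ 2 * ∑ i, y.V i ω ^ 2 := by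
      simp only [Finset.mul_sum, ← Finset.sum_add_distrib]
      exact Finset.sum_congr rfl fun i _ => by ring
    rw [e]
    nlinarith [mul_le_mul_of_nonneg_left h1 (sq_nonneg s), mul_le_mul_of_nonneg_left h2 (sq_nonneg t),
      mul_le_mul_of_nonneg_left hc'.2 (mul_nonneg hs ht)]
  · change (∑ ω, (s * x.K ω + t * y.K ω) ^ c.q) ^ (1 / c.q) ≤ (s * x.H + t * y.H) ^ (1 / (c.p - 1))
    refine (lp_convex c.q (by linarith [c.hq]) _ _ (fun ω => (xK ω).le) (fun ω => (yK ω).le) s t hs ht).trans ?_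
    have hcc := (Real.concaveOn_rpow (p := 1 / (c.p - 1)) (by have := c.p1; positivity)
      (by rw [div_le_one c.p1]; linarith [c.hp])).2 xH.le yH.le hs ht hst
    simp only [smul_eq_mul] at hcc
    refine le_trans ?_ hcc
    gcongr
  · change (∑ ω, (s * x.L ω + t * y.L ω) ^ c.e) ^ (1 / c.e) ≤ (s * x.H + t * y.H)
    refine (lp_convex c.e c.e1.le _ _ (fun ω => (xL ω).le) (fun ω => (yL ω).le) s t hs ht).trans ?_
    gcongr
  · change s * x.R ω + t * y.R ω ≤ (s * x.L ω + t * y.L ω) ^ (c.β * c.e ^ 2) * (s * x.H + t * y.H) ^ (c.b * c.e)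
    have h := mono_concave (c.β * c.e ^ 2) (c.b * c.e) (mul_nonneg c.β0 (sq_nonneg _))
      (mul_nonneg c.bnn (by linarith [c.e1])) c.ab_le _ _ _ _ s t (xL ω) xH (yL ω) yH hs ht hst
    refine le_trans ?_ h
    have := x4 ω
    have := y4 ω
    gcongr

lemma sumS_le {x : St n Ω} (hx : x ∈ c.D n Ω) : ∑ ω, c.S (x.K ω) (x.L ω) x.H ≤ 2 * x.H ^ c.e := by
  obtain ⟨⟨xK, xL, xR, xH⟩, x1, x2, x3, x4⟩ := hx
  have hq := c.q0
  have he : 0 < c.e := by linarith [c.e1]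
  have sK : 0 ≤ ∑ ω, x.K ω ^ c.q := Finset.sum_nonneg fun ω _ => Real.rpow_nonneg (xK ω).le _
  have sL : 0 ≤ ∑ ω, x.L ω ^ c.e := Finset.sum_nonneg fun ω _ => Real.rpow_nonneg (xL ω).le _
  have h1 : ∑ ω, x.K ω ^ c.q ≤ x.H ^ (c.q / (c.p - 1)) := by
    have := Real.rpow_le_rpow (by positivity) x2 hq.le
    rwa [← Real.rpow_mul sK, one_div_mul_cancel hq.ne', Real.rpow_one, ← Real.rpow_mul xH.le,
      one_div_mul_eq_div] at this
  have h2 : ∑ ω, x.L ω ^ c.e ≤ x.H ^ c.e := by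
    have := Real.rpow_le_rpow (by positivity) x3 he.le
    rwa [← Real.rpow_mul sL, one_div_mul_cancel he.ne', Real.rpow_one] at this
  unfold S
  rw [Finset.sum_add_distrib, ← Finset.sum_mul]
  have h3 : x.H ^ (c.q / (c.p - 1)) * x.H ^ c.b1 = x.H ^ c.e := by
    rw [← Real.rpow_add xH]; unfold b1 e; congr 1; rw [← add_div]; congr 1; ring
  have := mul_le_mul_of_nonneg_right h1 (Real.rpow_nonneg xH.le c.b1)
  linarith

lemma hess_lower {x : St n Ω} (hx : x ∈ c.D n Ω) (y : St n Ω) :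
    ∑ ω, (x.R ω ^ c.κ * ∑ i, y.V i ω ^ 2 + c.cκ * (x.R ω ^ (-c.κ) * y.G ω ^ 2)) ≤ hess c.B x y := by
  have hs := c.sumS_le hx
  have hU := hx.1
  obtain ⟨⟨xK, xL, xR, xH⟩, x1, x2, x3, x4⟩ := hx
  choose X Y Z hJ hZ using fun ω => c.term_jet (fun i => x.V i ω) (fun i => y.V i ω) (x.G ω) (y.G ω)
    (x.K ω) (y.K ω) (x.L ω) (y.L ω) (x.R ω) (y.R ω) x.H y.H (xK ω) (xL ω) (xR ω) xH (x1 ω) (x4 ω)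
  have J := (HasD2.sum Finset.univ fun ω _ => hJ ω).add
    (((HL.affine x.H y.H xH).rpow xH c.e).const_mul c.A2)
  have := hess_eq U_open c.B_contDiff hU y J
  rw [this]
  have h1 := Finset.sum_le_sum fun ω (_ : ω ∈ Finset.univ) => hZ ω
  rw [Finset.sum_sub_distrib, ← Finset.sum_mul, ← Finset.mul_sum] at h1
  have h2 : c.C7 * (∑ ω, c.S (x.K ω) (x.L ω) x.H) * (y.H / x.H) ^ 2 ≤
     c.C7 * (2 * x.H ^ c.e) * (y.H / x.H) ^ 2 := by
    have := c.C7nn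
    gcongr
  have h3 : c.A2 * (x.H ^ c.e * (c.e * 0 + c.e * (c.e - 1) * (y.H / x.H) ^ 2))
      = c.C7 * (2 * x.H ^ c.e) * (y.H / x.H) ^ 2 := by
    calc _ = c.A2 * (c.e * (c.e - 1)) * x.H ^ c.e * (y.H / x.H) ^ 2 := by ring
      _ = _ := by rw [c.A2e]; ring
  rw [h3]
  linarith

end Par
end

noncomputable section

/-- symbol of the inverse square root of the Laplacian -/
def m0 {n : ℕ} (A : Finset (Fin n)) : ℝ := if A = ∅ then 0 else (A.card : ℝ) ^ (-(1 / 2) : ℝ)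

lemma m0_psym2 {n : ℕ} (t : ℝ) (A : Finset (Fin n)) :
    4 * psym2 (2 * t) A * m0 A = -4 * (psym t A * psym1 t A) := by
  unfold m0 psym2 psym psym1
  split_ifs with h
  · subst h; simp
  · have hA : (0:ℝ) < A.card := by exact_mod_cast Finset.card_pos.2 (Finset.nonempty_iff_ne_empty.2 h)
    have e1 : (A.card : ℝ) * (A.card : ℝ) ^ (-(1 / 2) : ℝ) = Real.sqrt A.card := by
      rw [Real.sqrt_eq_rpow]
      nth_rw 1 [← Real.rpow_one (A.card : ℝ)]
      rw [← Real.rpow_add hA]; norm_num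
    have e2 : Real.exp (-(2 * t) * Real.sqrt A.card) = Real.exp (-t * Real.sqrt A.card) * Real.exp (-t * Real.sqrt A.card) := by
      rw [← Real.exp_add]; congr 1; ring
    rw [e2]
    calc _ = 4 * ((A.card : ℝ) * (A.card : ℝ) ^ (-(1 / 2) : ℝ)) * (Real.exp (-t * Real.sqrt A.card) * Real.exp (-t * Real.sqrt A.card)) := by ring
      _ = _ := by rw [e1]; ring

namespace Par
variable (c : Par) {n : ℕ} {Ω : Type} [Fintype Ω]

def Θ : ℝ := 8 + 1 / c.cκ

lemma flow_est (x0 : (Fin n → Bool) → St n Ω) (h0 : ∀ ε, x0 ε ∈ c.D n Ω)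
    (hodd : ∀ i ω ε, (x0 (flipCoord i ε)).V i ω = -(x0 ε).V i ω) :
    ∑ ω, ∑ ε, mult m0 (fun ε => ∑ i, (x0 ε).V i ω) ε * (x0 ε).G ω ≤ c.Θ * ∑ ε, c.B (x0 ε) := by
  have hU : IsOpen (U n Ω) := U_open
  have hP : ContDiffOn ℝ 2 (c.B : St n Ω → ℝ) (U n Ω) := c.B_contDiff
  have hcκ := c.cκ0
  set X : ℝ → (Fin n → Bool) → St n Ω := fun t ε => flow x0 (psym t) ε with hX
  have hD : ∀ t, 0 ≤ t → ∀ ε, X t ε ∈ c.D n Ω := fun t ht ε => flow_mem x0 c.D_convex h0 t ht ε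
  -- coordinates
  have hV : ∀ m i ω ε, (flow x0 m ε).V i ω = mult m (fun δ => (x0 δ).V i ω) ε := fun m i ω ε =>
    flow_clm x0 { toFun := fun x => x.V i ω, map_add' := fun _ _ => rfl, map_smul' := fun _ _ => rfl } m ε
  have hG : ∀ m ω ε, (flow x0 m ε).G ω = mult m (fun δ => (x0 δ).G ω) ε := fun m ω ε =>
    flow_clm x0 { toFun := fun x => x.G ω, map_add' := fun _ _ => rfl, map_smul' := fun _ _ => rfl } m ε
  set φ1 : ℝ → ℝ := fun t => ∑ ε, fderiv ℝ c.B (flow x0 (psym t) ε) (flow x0 (psym1 t) ε) with hφ1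
  set φ2 : ℝ → ℝ := fun t => (∑ ε, hess c.B (flow x0 (psym t) ε) (flow x0 (psym1 t) ε)
        + ∑ ε, ∑ i, (4:ℝ)⁻¹ * (fderiv ℝ c.B (flow x0 (psym t) ε)
            - fderiv ℝ c.B (flow x0 (psym t) (flipCoord i ε)))
              (flow x0 (psym t) ε - flow x0 (psym t) (flipCoord i ε))) with hφ2
  -- rho
  set h : Ω → (Fin n → Bool) → ℝ := fun ω => mult m0 (fun ε => ∑ i, (x0 ε).V i ω) with hh
  set ρ : ℝ → ℝ := fun t => ∑ ω, ∑ ε, mult (psym (2 * t)) (h ω) ε * (x0 ε).G ω with hρ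
  set ρ1 : ℝ → ℝ := fun t => ∑ ω, ∑ ε, mult (fun A => 2 * psym1 (2 * t) A) (h ω) ε * (x0 ε).G ω with hρ1
  set ρ2 : ℝ → ℝ := fun t => ∑ ω, ∑ ε, mult (fun A => 4 * psym2 (2 * t) A) (h ω) ε * (x0 ε).G ω with hρ2
  have dρ : ∀ t, HasDerivAt ρ (ρ1 t) t := by
    intro t
    refine HasDerivAt.fun_sum fun ω _ => HasDerivAt.fun_sum fun ε _ => HasDerivAt.mul_const ?_ _
    refine mult_hasDeriv (fun t => psym (2 * t)) (fun t A => 2 * psym1 (2 * t) A) t (fun A => ?_) _ _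
    have := (psym_deriv (2 * t) A).comp t ((hasDerivAt_id t).const_mul 2)
    exact this.congr_deriv (by ring)
  have dρ1 : ∀ t, HasDerivAt ρ1 (ρ2 t) t := by
    intro t
    refine HasDerivAt.fun_sum fun ω _ => HasDerivAt.fun_sum fun ε _ => HasDerivAt.mul_const ?_ _
    refine mult_hasDeriv (fun t A => 2 * psym1 (2 * t) A) (fun t A => 4 * psym2 (2 * t) A) t (fun A => ?_) _ _
    have := ((psym1_deriv (2 * t) A).comp t ((hasDerivAt_id t).const_mul 2)).const_mul 2
    exact this.congr_deriv (by ring)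
  have lρ : Filter.Tendsto ρ Filter.atTop (nhds 0) := by
    have e : (0:ℝ) = ∑ ω, ∑ ε : Fin n → Bool, mult (fun A => if A = ∅ then 1 else 0) (h ω) ε * (x0 ε).G ω := by
      symm
      refine Finset.sum_eq_zero fun ω _ => Finset.sum_eq_zero fun ε _ => ?_
      rw [mult_zero_sym, hh, wcoef_mult]; simp [m0]
    rw [e]
    refine tendsto_finsetSum _ fun ω _ => tendsto_finsetSum _ fun ε _ => Filter.Tendsto.mul_const _ ?_
    exact (mult_tendsto (h ω) ε).comp (Filter.tendsto_id.const_mul_atTop (by norm_num : (0:ℝ) < 2))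
  -- limit of phi
  set Y : (Fin n → Bool) → St n Ω := fun ε => flow x0 (fun A => if A = ∅ then 1 else 0) ε with hY
  have hYU : ∀ ε, Y ε ∈ U n Ω := by
    intro ε
    have e : ∀ δ : Fin n → Bool, pker (fun A : Finset (Fin n) => if A = ∅ then 1 else 0) ε δ = (2 ^ n : ℝ)⁻¹ := by
      intro δ; simp [pker, walshChar]
    refine U_convex.sum_mem (fun δ _ => ?_) ?_ (fun δ _ => (h0 δ).1)
    · rw [e]; positivity
    · simp [e]
  have lφ : Filter.Tendsto (fun t => ∑ ε, c.B (X t ε)) Filter.atTop (nhds (∑ ε, c.B (Y ε))) := by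
    refine tendsto_finsetSum _ fun ε _ => ?_
    have hc : ContinuousAt c.B (Y ε) := (hP.contDiffAt (hU.mem_nhds (hYU ε))).continuousAt
    exact hc.tendsto.comp (flow_tendsto x0 ε)
  have hcmp : ∀ t, 0 ≤ t → ρ2 t ≤ c.Θ * φ2 t := by
    intro t ht
    set vd : Fin n → Ω → (Fin n → Bool) → ℝ := fun i ω => mult (psym1 t) (fun δ => (x0 δ).V i ω) with hvd
    set g : Ω → (Fin n → Bool) → ℝ := fun ω => mult (psym t) (fun δ => (x0 δ).G ω) with hg
    set r : Ω → (Fin n → Bool) → ℝ := fun ω ε => (X t ε).R ω with hr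
    have rpos : ∀ ω ε, 0 < r ω ε := fun ω ε => (hD t ht ε).1.2.2.1 ω
    set mx : Fin n → Ω → (Fin n → Bool) → ℝ := fun i ω ε => max (r ω ε) (r ω (flipCoord i ε)) with hmx
    have mxpos : ∀ i ω ε, 0 < mx i ω ε := fun i ω ε => lt_max_of_lt_left (rpos ω ε)
    set T1 := ∑ ε, ∑ i, ∑ ω, r ω ε ^ c.κ * vd i ω ε ^ 2 with hT1
    set T2 := ∑ ε, ∑ i, ∑ ω, (4:ℝ)⁻¹ * (mx i ω ε ^ (-c.κ) * (g ω ε - g ω (flipCoord i ε)) ^ 2) with hT2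
    have T1n : 0 ≤ T1 := Finset.sum_nonneg fun ε _ => Finset.sum_nonneg fun i _ => Finset.sum_nonneg fun ω _ => by
      have := rpos ω ε; positivity
    have T2n : 0 ≤ T2 := Finset.sum_nonneg fun ε _ => Finset.sum_nonneg fun i _ => Finset.sum_nonneg fun ω _ => by
      have := mxpos i ω ε; positivity
    -- lower bound phi
    have hφ : T1 + c.cκ * T2 ≤ φ2 t := by
      rw [hφ2]
      refine add_le_add ?_ ?_
      · refine Finset.sum_le_sum fun ε _ => ?_
        refine le_trans ?_ (c.hess_lower (hD t ht ε) _)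
        rw [Finset.sum_comm]
        refine Finset.sum_le_sum fun ω _ => ?_
        rw [← Finset.mul_sum]
        simp only [hV]
        have := rpos ω ε
        refine le_add_of_nonneg_right ?_
        exact mul_nonneg hcκ.le (mul_nonneg (Real.rpow_nonneg this.le _) (sq_nonneg _))
      · rw [hT2, Finset.mul_sum]
        refine Finset.sum_le_sum fun ε _ => ?_
        rw [Finset.mul_sum]
        refine Finset.sum_le_sum fun i _ => ?_
        rw [← Finset.mul_sum, mul_left_comm]
        refine mul_le_mul_of_nonneg_left ?_ (by norm_num)
        set x := flow x0 (psym t) (flipCoord i ε) with hx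
        set y := flow x0 (psym t) ε with hy
        have hseg : ∀ s ∈ Set.Icc (0:ℝ) 1, x + s • (y - x) ∈ c.D n Ω := by
          intro s hs
          exact c.D_convex.add_smul_sub_mem (hD t ht _) (hD t ht _) hs
        refine edge_mono hU hP x y _ (fun s hs => (hseg s hs).1) (fun s hs => ?_)
        refine le_trans ?_ (c.hess_lower (hseg s hs) _)
        rw [Finset.mul_sum]
        refine Finset.sum_le_sum fun ω _ => ?_
        have Rp : 0 < (x + s • (y - x)).R ω := (hseg s hs).1.2.2.1 ω
        have Rl : (x + s • (y - x)).R ω ≤ mx i ω ε := by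
          change x.R ω + s * (y.R ω - x.R ω) ≤ max (y.R ω) (x.R ω)
          have h1 := le_max_left (y.R ω) (x.R ω)
          have h2 := le_max_right (y.R ω) (x.R ω)
          nlinarith [mul_nonneg hs.1 (sub_nonneg.2 h1), mul_nonneg (sub_nonneg.2 hs.2) (sub_nonneg.2 h2)]
        have Rk : mx i ω ε ^ (-c.κ) ≤ (x + s • (y - x)).R ω ^ (-c.κ) :=
          Real.rpow_le_rpow_of_nonpos Rp Rl (by linarith [c.κ0])
        have eG : (y - x).G ω = g ω ε - g ω (flipCoord i ε) := by
          change y.G ω - x.G ω = _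
          rw [hy, hx, hG, hG]
        rw [eG]
        refine le_trans ?_ (le_add_of_nonneg_left ?_)
        · gcongr
        · exact mul_nonneg (Real.rpow_nonneg Rp.le _) (Finset.sum_nonneg fun _ _ => sq_nonneg _)
    -- upper bound rho
    have hρ' : ρ2 t ≤ T2 + 8 * T1 := by
      have vodd : ∀ i ω ε, vd i ω (flipCoord i ε) = - vd i ω ε := by
        intro i ω ε
        rw [hvd]
        simp only
        rw [mult_flip]
        have : (fun ε => (x0 (flipCoord i ε)).V i ω) = fun ε => (-1) * (x0 ε).V i ω := by
          funext ε; rw [hodd]; ring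
        rw [this, mult_smul]; ring
      have e1 : ρ2 t = ∑ ε, ∑ i, ∑ ω, (-2 * (vd i ω ε * (g ω ε - g ω (flipCoord i ε)))) := by
        have step : ∀ ω, ∑ ε, mult (fun A => 4 * psym2 (2 * t) A) (h ω) ε * (x0 ε).G ω
            = ∑ i, ∑ ε, (-2 * (vd i ω ε * (g ω ε - g ω (flipCoord i ε)))) := by
          intro ω
          have s1 : mult (fun A => 4 * psym2 (2 * t) A) (h ω)
              = mult (psym t) (mult (fun A => -4 * psym1 t A) (fun ε => ∑ i, (x0 ε).V i ω)) := by
            rw [hh]; simp only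
            rw [mult_mult, mult_mult]
            congr 1; funext A; rw [m0_psym2]; ring
          rw [s1, mult_selfadj]
          have s2 : ∀ ε, mult (fun A => -4 * psym1 t A) (fun ε => ∑ i, (x0 ε).V i ω) ε = -4 * ∑ i, vd i ω ε := by
            intro ε
            rw [← mult_sum, ← mult_smul]
            unfold mult
            refine Finset.sum_congr rfl fun A _ => ?_
            have : wcoef (fun ε => -4 * ∑ i, (x0 ε).V i ω) A = -4 * wcoef (fun ε => ∑ i, (x0 ε).V i ω) A := by
              rw [wcoef_real, wcoef_real]; simp only [Finset.mul_sum]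
              exact Finset.sum_congr rfl fun _ _ => Finset.sum_congr rfl fun _ _ => by ring
            rw [this]; ring
          simp only [s2]
          simp only [mul_assoc, Finset.sum_mul, Finset.mul_sum]
          rw [Finset.sum_comm]
          refine Finset.sum_congr rfl fun i _ => ?_
          have := csum_flip i (fun ε => vd i ω ε * g ω ε)
          simp only [vodd] at this
          simp only [← Finset.mul_sum, mul_sub, Finset.sum_sub_distrib]
          simp only [neg_mul, Finset.sum_neg_distrib] at this
          change -4 * ∑ ε, vd i ω ε * g ω ε = _
          linarith
        rw [hρ2]; simp only [step]
        rw [Finset.sum_comm]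
        conv_rhs => rw [Finset.sum_comm]
        refine Finset.sum_congr rfl fun i _ => ?_
        rw [Finset.sum_comm]
      have e2 : ρ2 t ≤ T2 + ∑ ε, ∑ i, ∑ ω, 4 * (mx i ω ε ^ c.κ * vd i ω ε ^ 2) := by
        rw [e1, hT2]
        simp only [← Finset.sum_add_distrib]
        refine Finset.sum_le_sum fun ε _ => Finset.sum_le_sum fun i _ => Finset.sum_le_sum fun ω _ => ?_
        have hm := mxpos i ω ε
        rw [Real.rpow_neg hm.le]
        set m := mx i ω ε ^ c.κ with hmd
        have hm' : 0 < m := Real.rpow_pos_of_pos hm _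
        set a := vd i ω ε
        set d := g ω ε - g ω (flipCoord i ε)
        have : (4:ℝ)⁻¹ * (m⁻¹ * d ^ 2) + 4 * (m * a ^ 2) + 2 * (a * d) = m⁻¹ * (d / 2 + 2 * (m * a)) ^ 2 := by
          field_simp; ring
        have : 0 ≤ m⁻¹ * (d / 2 + 2 * (m * a)) ^ 2 := by positivity
        linarith
      have e3 : ∑ ε, ∑ i, ∑ ω, 4 * (mx i ω ε ^ c.κ * vd i ω ε ^ 2) ≤ 8 * T1 := by
        have f1 : ∑ ε, ∑ i, ∑ ω, r ω (flipCoord i ε) ^ c.κ * vd i ω ε ^ 2 = T1 := by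
          rw [hT1, Finset.sum_comm]
          conv_rhs => rw [Finset.sum_comm]
          refine Finset.sum_congr rfl fun i _ => ?_
          rw [← csum_flip i (fun ε => ∑ ω, r ω ε ^ c.κ * vd i ω ε ^ 2)]
          simp only [vodd, neg_sq]
        have f2 : 8 * T1 = 4 * T1 + 4 * T1 := by ring
        rw [f2]
        nth_rw 2 [← f1]
        rw [hT1]
        simp only [Finset.mul_sum, ← Finset.sum_add_distrib]
        refine Finset.sum_le_sum fun ε _ => Finset.sum_le_sum fun i _ => Finset.sum_le_sum fun ω _ => ?_
        have h1 := Real.rpow_nonneg (rpos ω ε).le c.κ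
        have h2 := Real.rpow_nonneg (rpos ω (flipCoord i ε)).le c.κ
        have : mx i ω ε ^ c.κ ≤ r ω ε ^ c.κ + r ω (flipCoord i ε) ^ c.κ := by
          change max _ _ ^ _ ≤ _
          rcases max_choice (r ω ε) (r ω (flipCoord i ε)) with hc | hc <;> rw [hc] <;> linarith
        nlinarith [mul_le_mul_of_nonneg_right this (sq_nonneg (vd i ω ε))]
      linarith
    have : c.Θ * (T1 + c.cκ * T2) ≤ c.Θ * φ2 t := by
      refine mul_le_mul_of_nonneg_left hφ ?_
      unfold Θ; positivity
    have e : c.Θ * (T1 + c.cκ * T2) = 8 * T1 + 1 / c.cκ * T1 + 8 * c.cκ * T2 + T2 := by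
      unfold Θ; field_simp; ring
    have : 0 ≤ 1 / c.cκ * T1 := by positivity
    have : 0 ≤ 8 * c.cκ * T2 := by positivity
    linarith
  have key := convex_end (fun t => c.Θ * (∑ ε, c.B (X t ε)) - ρ t) (fun t => c.Θ * φ1 t - ρ1 t)
    (fun t => c.Θ * φ2 t - ρ2 t) (c.Θ * (∑ ε, c.B (Y ε)) - 0)
    (fun t ht => ((flow_phi_deriv hU hP x0 t fun ε => (hD t ht ε).1).const_mul _).sub (dρ t))
    (fun t ht => ((flow_phi_deriv2 hU hP x0 t fun ε => (hD t ht ε).1).const_mul _).sub (dρ1 t))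
    (fun t ht => sub_nonneg.2 (hcmp t ht)) ((lφ.const_mul _).sub lρ)
  have hΘ : 0 ≤ c.Θ := by unfold Θ; positivity
  have hn : 0 ≤ c.Θ * ∑ ε, c.B (Y ε) := mul_nonneg hΘ (Finset.sum_nonneg fun ε _ => c.B_nonneg (hYU ε))
  have e1 : ρ 0 = ∑ ω, ∑ ε, mult m0 (fun ε => ∑ i, (x0 ε).V i ω) ε * (x0 ε).G ω := by
    simp only [hρ, mul_zero, psym_zero, mult_one, hh]
  have e2 : ∀ ε, X 0 ε = x0 ε := fun ε => flow_zero x0 ε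
  simp only [e2, e1] at key
  linarith
end Par
end

noncomputable section

namespace Par
variable (c : Par) {n : ℕ} {Ω : Type} [Fintype Ω]

/-- the norm of `ℓ^q(Ω)` -/
def nrm (f : Ω → ℝ) : ℝ := (∑ ω, |f ω| ^ c.q) ^ (1 / c.q)

def Cb : ℝ := c.Θ * (3 + 2 * c.A1 + c.A2)

lemma nrm_nonneg (f : Ω → ℝ) : 0 ≤ c.nrm f :=
  Real.rpow_nonneg (Finset.sum_nonneg fun _ _ => Real.rpow_nonneg (abs_nonneg _) _) _

lemma nrm_pow (f : Ω → ℝ) : c.nrm f ^ c.q = ∑ ω, |f ω| ^ c.q := by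
  unfold nrm
  rw [← Real.rpow_mul (Finset.sum_nonneg fun _ _ => Real.rpow_nonneg (abs_nonneg _) _),
    one_div_mul_cancel c.q0.ne', Real.rpow_one]

lemma nrm_mono (f g : Ω → ℝ) (h : ∀ ω, |f ω| ≤ |g ω|) : c.nrm f ≤ c.nrm g := by
  have := c.q0
  unfold nrm
  refine Real.rpow_le_rpow (Finset.sum_nonneg fun _ _ => Real.rpow_nonneg (abs_nonneg _) _) ?_ (by positivity)
  exact Finset.sum_le_sum fun ω _ => Real.rpow_le_rpow (abs_nonneg _) (h ω) this.le

lemma bilin [Nonempty Ω] (F : Fin n → Ω → (Fin n → Bool) → ℝ)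
    (hodd : ∀ i ω ε, F i ω (flipCoord i ε) = - F i ω ε) (g k0 : Ω → (Fin n → Bool) → ℝ)
    (hk : ∀ ω ε, 0 < k0 ω ε) (hF : ∀ ω ε, ∑ i, F i ω ε ^ 2 ≤ k0 ω ε ^ 2)
    (hg : ∀ ω ε, |g ω ε| ≤ c.nrm (fun ω => k0 ω ε) ^ (c.p - c.q) * k0 ω ε ^ (c.q - 1)) :
    ∑ ω, ∑ ε, mult m0 (fun ε => ∑ i, F i ω ε) ε * g ω ε ≤ c.Cb * ∑ ε, c.nrm (fun ω => k0 ω ε) ^ c.p := by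
  set T : (Fin n → Bool) → ℝ := fun ε => c.nrm (fun ω => k0 ω ε) with hT
  have hq := c.q0
  have hp := c.p0
  have hp1 := c.p1
  have he : 0 < c.e := by linarith [c.e1]
  have hTs : ∀ ε, ∑ ω, k0 ω ε ^ c.q = T ε ^ c.q := by
    intro ε
    rw [hT]; simp only; rw [nrm_pow]
    exact Finset.sum_congr rfl fun ω _ => by rw [abs_of_pos (hk ω ε)]
  have hTp : ∀ ε, 0 < T ε := by
    intro ε
    refine Real.rpow_pos_of_pos (Finset.sum_pos (fun ω _ => ?_) Finset.univ_nonempty) _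
    exact Real.rpow_pos_of_pos (abs_pos.2 (hk ω ε).ne') _
  set x0 : (Fin n → Bool) → St n Ω := fun ε => (fun i ω => F i ω ε, fun ω => g ω ε, fun ω => k0 ω ε,
    fun ω => (T ε ^ (c.p - c.q) * k0 ω ε ^ c.q) ^ c.κ,
    fun ω => (T ε ^ (c.p - c.q) * k0 ω ε ^ (c.q - 2)) ^ c.e, T ε ^ (c.p - 1)) with hx0
  have pκ : c.p * c.κ = c.p - 1 := by unfold κ; field_simp
  have pe : (c.p - 1) * c.e = c.p := by unfold e; field_simp
  have ek := c.eκ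
  have ke : c.κ * c.e = 1 := by rw [mul_comm]; exact ek
  have LE : ∀ ω ε, ((T ε ^ (c.p - c.q) * k0 ω ε ^ c.q) ^ c.κ) ^ c.e = T ε ^ (c.p - c.q) * k0 ω ε ^ c.q := by
    intro ω ε
    have := hTp ε; have := hk ω ε
    rw [← Real.rpow_mul (by positivity), ke, Real.rpow_one]
  have sY : ∀ ε, ∑ ω, T ε ^ (c.p - c.q) * k0 ω ε ^ c.q = T ε ^ c.p := by
    intro ε
    rw [← Finset.mul_sum, hTs, ← Real.rpow_add (hTp ε)]; congr 1; ring
  have h0 : ∀ ε, x0 ε ∈ c.D n Ω := by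
    intro ε
    have hTe := hTp ε
    refine ⟨⟨fun ω => hk ω ε, fun ω => ?_, fun ω => ?_, ?_⟩, fun ω => hF ω ε, ?_, ?_, fun ω => ?_⟩
    · have := hk ω ε
      change 0 < (T ε ^ (c.p - c.q) * k0 ω ε ^ c.q) ^ c.κ
      positivity
    · have := hk ω ε
      change 0 < (T ε ^ (c.p - c.q) * k0 ω ε ^ (c.q - 2)) ^ c.e
      positivity
    · change 0 < T ε ^ (c.p - 1)
      positivity
    · change (∑ ω, k0 ω ε ^ c.q) ^ (1 / c.q) ≤ (T ε ^ (c.p - 1)) ^ (1 / (c.p - 1))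
      rw [hTs, ← Real.rpow_mul hTe.le, ← Real.rpow_mul hTe.le, mul_one_div_cancel hq.ne', mul_one_div_cancel hp1.ne']
    · change (∑ ω, ((T ε ^ (c.p - c.q) * k0 ω ε ^ c.q) ^ c.κ) ^ c.e) ^ (1 / c.e) ≤ T ε ^ (c.p - 1)
      simp only [LE]
      rw [sY, ← Real.rpow_mul hTe.le]
      have : 1 / c.e = c.κ := by rw [div_eq_iff he.ne', ke]
      rw [this, pκ]
    · change (T ε ^ (c.p - c.q) * k0 ω ε ^ (c.q - 2)) ^ c.e ≤
        ((T ε ^ (c.p - c.q) * k0 ω ε ^ c.q) ^ c.κ) ^ (c.β * c.e ^ 2) * (T ε ^ (c.p - 1)) ^ (c.b * c.e)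
      have hkω := hk ω ε
      apply le_of_eq
      rw [← Real.rpow_mul (by positivity), Real.mul_rpow (by positivity) (by positivity),
        Real.mul_rpow (by positivity) (by positivity), ← Real.rpow_mul hTe.le, ← Real.rpow_mul hkω.le,
        ← Real.rpow_mul hTe.le, ← Real.rpow_mul hkω.le, ← Real.rpow_mul hTe.le, mul_right_comm, ← Real.rpow_add hTe]
      have k1 : c.κ * (c.β * c.e ^ 2) = c.β * c.e := by
        calc _ = c.β * c.e * (c.κ * c.e) := by ring
          _ = _ := by rw [ke, mul_one]
      rw [k1]
      congr 2
      · unfold b b1 β; field_simp; ring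
      · unfold β; field_simp
  have hE := c.flow_est x0 h0 (fun i ω ε => hodd i ω ε)
  refine hE.trans ?_
  have hΘ : 0 ≤ c.Θ := by unfold Θ; have := c.cκ0; positivity
  unfold Cb
  rw [mul_assoc]
  refine mul_le_mul_of_nonneg_left ?_ hΘ
  rw [Finset.mul_sum]
  refine Finset.sum_le_sum fun ε _ => ?_
  have hTe := hTp ε
  have HE : (T ε ^ (c.p - 1)) ^ c.e = T ε ^ c.p := by rw [← Real.rpow_mul hTe.le, pe]
  have Hb : (T ε ^ (c.p - 1)) ^ c.b1 = T ε ^ (c.p - c.q) := by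
    rw [← Real.rpow_mul hTe.le]; unfold b1; rw [mul_div_cancel₀ _ hp1.ne']
  change (∑ ω, c.term (fun i => F i ω ε) (g ω ε) (k0 ω ε) ((T ε ^ (c.p - c.q) * k0 ω ε ^ c.q) ^ c.κ)
    ((T ε ^ (c.p - c.q) * k0 ω ε ^ (c.q - 2)) ^ c.e) (T ε ^ (c.p - 1))) + c.A2 * (T ε ^ (c.p - 1)) ^ c.e ≤ _
  rw [HE]
  have hterm : ∀ ω, c.term (fun i => F i ω ε) (g ω ε) (k0 ω ε) ((T ε ^ (c.p - c.q) * k0 ω ε ^ c.q) ^ c.κ)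
    ((T ε ^ (c.p - c.q) * k0 ω ε ^ (c.q - 2)) ^ c.e) (T ε ^ (c.p - 1))
      ≤ (3 + 2 * c.A1) * (T ε ^ (c.p - c.q) * k0 ω ε ^ c.q) := by
    intro ω
    have hkω := hk ω ε
    have hL : 0 < (T ε ^ (c.p - c.q) * k0 ω ε ^ c.q) ^ c.κ := by positivity
    have hH : 0 < T ε ^ (c.p - 1) := by positivity
    have hKZ := c.KZ_le hkω hL hH
    have hS : c.S (k0 ω ε) ((T ε ^ (c.p - c.q) * k0 ω ε ^ c.q) ^ c.κ) (T ε ^ (c.p - 1))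
      = 2 * (T ε ^ (c.p - c.q) * k0 ω ε ^ c.q) := by
      unfold S; rw [LE, Hb]; ring
    have hSp := c.S_pos hkω hL hH
    unfold term
    rw [hS] at hKZ hSp ⊢
    have t1 : (∑ i, F i ω ε ^ 2) * ((T ε ^ (c.p - 1)) ^ c.b * (2 * (T ε ^ (c.p - c.q) * k0 ω ε ^ c.q)) ^ c.β)
       ≤ 2 * (T ε ^ (c.p - c.q) * k0 ω ε ^ c.q) :=
      (mul_le_mul_of_nonneg_right (hF ω ε) (by positivity)).trans hKZ
    have t2 : g ω ε ^ 2 * ((T ε ^ (c.p - c.q) * k0 ω ε ^ (c.q - 2)) ^ c.e) ^ (-c.κ)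
        ≤ T ε ^ (c.p - c.q) * k0 ω ε ^ c.q := by
      rw [← Real.rpow_mul (by positivity), mul_neg, ek, Real.rpow_neg_one, ← div_eq_mul_inv, div_le_iff₀ (by positivity)]
      have h1 : g ω ε ^ 2 ≤ (T ε ^ (c.p - c.q) * k0 ω ε ^ (c.q - 1)) ^ 2 := by
        rw [← sq_abs (g ω ε)]
        exact pow_le_pow_left₀ (abs_nonneg _) (hg ω ε) 2
      refine h1.trans (le_of_eq ?_)
      have h2 : k0 ω ε ^ c.q = k0 ω ε ^ (c.q - 1) * k0 ω ε := by
        rw [Real.rpow_sub_one hkω.ne']; field_simp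
      have h3 : k0 ω ε ^ (c.q - 1) = k0 ω ε ^ (c.q - 2) * k0 ω ε := by
        rw [← Real.rpow_add_one hkω.ne']; congr 1; ring
      rw [h2]; nth_rw 2 [h3]; rw [h3]; ring
    linarith
  have := Finset.sum_le_sum fun ω (_ : ω ∈ Finset.univ) => hterm ω
  rw [← Finset.mul_sum, sY] at this
  linarith

lemma Cb_nonneg : 0 ≤ c.Cb := by
  unfold Cb Θ; have := c.cκ0; have := c.A1nn; have := c.A2nn; positivity

lemma nrm_add3 (a b d : ℝ) (ha : 0 ≤ a) (hb : 0 ≤ b) (hd : 0 ≤ d) (f g h : Ω → ℝ)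
    (hf : ∀ ω, 0 ≤ f ω) (hg : ∀ ω, 0 ≤ g ω) (hh : ∀ ω, 0 ≤ h ω) :
    c.nrm (fun ω => a * f ω + b * g ω + d * h ω) ≤ a * c.nrm f + b * c.nrm g + d * c.nrm h := by
  have q1 : 1 ≤ c.q := by linarith [c.hq]
  have e : ∀ f : Ω → ℝ, (∀ ω, 0 ≤ f ω) → c.nrm f = (∑ ω, f ω ^ c.q) ^ (1 / c.q) := by
    intro f hf; unfold nrm; simp only [fun ω => abs_of_nonneg (hf ω)]
  rw [e f hf, e g hg, e h hh, e _ (fun ω => by have := hf ω; have := hg ω; have := hh ω; positivity)]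
  have h1 := lp_convex c.q q1 (fun ω => a * f ω + b * g ω) h (fun ω => by have := hf ω; have := hg ω; positivity) hh
    1 d zero_le_one hd
  have h2 := lp_convex c.q q1 f g hf hg a b ha hb
  simp only [one_mul] at h1
  linarith

def Cf : ℝ := (2 * (c.Cb * 3 ^ c.p + 1)) ^ c.p

set_option maxHeartbeats 2000000 in
lemma core_aux [Nonempty Ω] (F : Fin n → Ω → (Fin n → Bool) → ℝ)
    (hodd : ∀ i ω ε, F i ω (flipCoord i ε) = - F i ω ε) :
    ∑ ε, c.nrm (fun ω => mult m0 (fun ε => ∑ i, F i ω ε) ε) ^ c.p ≤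
      c.Cf * ∑ ε, c.nrm (fun ω => Real.sqrt (∑ i, F i ω ε ^ 2)) ^ c.p := by
  have hq := c.q0
  have hp := c.p0
  have hCb := c.Cb_nonneg
  set u : Ω → (Fin n → Bool) → ℝ := fun ω => mult m0 (fun ε => ∑ i, F i ω ε) with hu
  set w : Ω → (Fin n → Bool) → ℝ := fun ω ε => Real.sqrt (∑ i, F i ω ε ^ 2) with hw
  have hw0 : ∀ ω ε, 0 ≤ w ω ε := fun ω ε => Real.sqrt_nonneg _
  set s : ℝ := 2 * (c.Cb * 3 ^ c.p + 1) with hs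
  have hs0 : 0 < s := by positivity
  change ∑ ε, c.nrm (fun ω => u ω ε) ^ c.p ≤ s ^ c.p * ∑ ε, c.nrm (fun ω => w ω ε) ^ c.p
  set d : ℝ := c.nrm (fun _ : Ω => (1:ℝ)) with hd
  have hd0 : 0 < d := by
    refine Real.rpow_pos_of_pos (Finset.sum_pos (fun ω _ => ?_) Finset.univ_nonempty) _
    simp
  -- main inequality for each η
  have main : ∀ η : ℝ, 0 < η → ∑ ε, c.nrm (fun ω => u ω ε) ^ c.p ≤
      s ^ c.p * ∑ ε, c.nrm (fun ω => w ω ε) ^ c.p + 2 ^ n * (η * d) ^ c.p := by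
    intro η hη
    set k0 : Ω → (Fin n → Bool) → ℝ := fun ω ε => s * w ω ε + 1 * |u ω ε| + η * 1 with hk0
    have hk : ∀ ω ε, 0 < k0 ω ε := fun ω ε => by
      have := hw0 ω ε; rw [hk0]; positivity
    have huk : ∀ ω ε, |u ω ε| ≤ k0 ω ε := fun ω ε => by
      have := mul_nonneg hs0.le (hw0 ω ε); rw [hk0]; simp only; linarith
    have B := c.bilin (fun i ω ε => s * F i ω ε) (fun i ω ε => by rw [hodd]; ring)
      (fun ω ε => c.nrm (fun ω => u ω ε) ^ (c.p - c.q) * (|u ω ε| ^ (c.q - 2) * u ω ε)) k0 hk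
      (fun ω ε => by
        have h1 : s * w ω ε ≤ k0 ω ε := by
          have := abs_nonneg (u ω ε); rw [hk0]; simp only; linarith
        have h2 : ∑ i, (s * F i ω ε) ^ 2 = (s * w ω ε) ^ 2 := by
          rw [mul_pow, hw]; simp only
          rw [Real.sq_sqrt (Finset.sum_nonneg fun _ _ => sq_nonneg _), Finset.mul_sum]
          simp only [mul_pow]
        rw [h2]
        exact pow_le_pow_left₀ (mul_nonneg hs0.le (hw0 ω ε)) h1 2)
      (fun ω ε => by
        have hn := c.nrm_nonneg (fun ω => u ω ε)
        rw [abs_mul, abs_of_nonneg (Real.rpow_nonneg hn _), abs_mul,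
          abs_of_nonneg (Real.rpow_nonneg (abs_nonneg _) _)]
        have h1 : |u ω ε| ^ (c.q - 2) * |u ω ε| = |u ω ε| ^ (c.q - 1) := by
          have := Real.rpow_add_of_nonneg (abs_nonneg (u ω ε)) (show 0 ≤ c.q - 2 by linarith [c.hq]) zero_le_one
          rw [Real.rpow_one] at this
          rw [← this]; congr 1; ring
        rw [h1]
        refine mul_le_mul (Real.rpow_le_rpow hn ?_ (by linarith [c.hqp]))
          (Real.rpow_le_rpow (abs_nonneg _) (huk ω ε) (by linarith [c.hq])) (Real.rpow_nonneg (abs_nonneg _) _)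
          (Real.rpow_nonneg (c.nrm_nonneg _) _)
        exact c.nrm_mono _ _ fun ω => (huk ω ε).trans (le_abs_self _))
    have e1 : ∑ ω, ∑ ε, mult m0 (fun ε => ∑ i, s * F i ω ε) ε *
        (c.nrm (fun ω => u ω ε) ^ (c.p - c.q) * (|u ω ε| ^ (c.q - 2) * u ω ε))
        = s * ∑ ε, c.nrm (fun ω => u ω ε) ^ c.p := by
      rw [Finset.sum_comm, Finset.mul_sum]
      refine Finset.sum_congr rfl fun ε _ => ?_
      have hn := c.nrm_nonneg (fun ω => u ω ε)
      have t1 : ∀ ω, mult m0 (fun ε => ∑ i, s * F i ω ε) ε = s * u ω ε := by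
        intro ω; rw [hu]; simp only [← Finset.mul_sum]; rw [mult_smul]
      have t2 : ∀ ω, |u ω ε| ^ (c.q - 2) * (u ω ε * u ω ε) = |u ω ε| ^ c.q := by
        intro ω
        have := Real.rpow_add_of_nonneg (abs_nonneg (u ω ε)) (show 0 ≤ c.q - 2 by linarith [c.hq]) zero_le_two
        rw [sub_add_cancel, Real.rpow_two, sq_abs] at this
        rw [this]; ring
      calc _ = ∑ ω, s * (c.nrm (fun ω => u ω ε) ^ (c.p - c.q) * (|u ω ε| ^ (c.q - 2) * (u ω ε * u ω ε))) :=
            Finset.sum_congr rfl fun ω _ => by rw [t1]; ring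
        _ = _ := by
          simp only [t2, ← Finset.mul_sum]
          rw [← nrm_pow, ← Real.rpow_add_of_nonneg hn (by linarith [c.hqp]) hq.le, sub_add_cancel]
    rw [e1] at B
    have e2 : ∀ ε, c.nrm (fun ω => k0 ω ε) ^ c.p ≤ 3 ^ c.p * (s ^ c.p * c.nrm (fun ω => w ω ε) ^ c.p
        + c.nrm (fun ω => u ω ε) ^ c.p + (η * d) ^ c.p) := by
      intro ε
      have h1 := c.nrm_add3 s 1 η hs0.le zero_le_one hη.le (fun ω => w ω ε) (fun ω => |u ω ε|) (fun _ => 1)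
        (fun ω => hw0 ω ε) (fun ω => abs_nonneg _) (fun _ => zero_le_one)
      have h2 : c.nrm (fun ω => |u ω ε|) = c.nrm (fun ω => u ω ε) := by unfold nrm; simp only [abs_abs]
      rw [h2, one_mul] at h1
      set a := s * c.nrm (fun ω => w ω ε) with ha
      set b := c.nrm (fun ω => u ω ε) with hb
      have ha0 : 0 ≤ a := mul_nonneg hs0.le (c.nrm_nonneg _)
      have hb0 : 0 ≤ b := c.nrm_nonneg _
      have hd1 : 0 ≤ η * d := by positivity
      have h3 : s ^ c.p * c.nrm (fun ω => w ω ε) ^ c.p = a ^ c.p := by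
        rw [ha, Real.mul_rpow hs0.le (c.nrm_nonneg _)]
      rw [h3]
      refine (Real.rpow_le_rpow (c.nrm_nonneg _) h1 hp.le).trans ?_
      have h4 : a + b + η * d ≤ 3 * max a (max b (η * d)) := by
        have := le_max_left a (max b (η * d))
        have := le_max_right a (max b (η * d))
        have := le_max_left b (η * d)
        have := le_max_right b (η * d)
        linarith
      refine (Real.rpow_le_rpow (by positivity) h4 hp.le).trans ?_
      rw [Real.mul_rpow (by norm_num) (le_max_of_le_left ha0)]
      refine mul_le_mul_of_nonneg_left ?_ (by positivity)
      have p1 := Real.rpow_nonneg ha0 c.p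
      have p2 := Real.rpow_nonneg hb0 c.p
      have p3 := Real.rpow_nonneg hd1 c.p
      rcases max_choice a (max b (η * d)) with h | h <;> rw [h]
      · linarith
      · rcases max_choice b (η * d) with h | h <;> rw [h] <;> linarith
    have e3 := Finset.sum_le_sum fun ε (_ : ε ∈ (Finset.univ : Finset (Fin n → Bool))) => e2 ε
    rw [← Finset.mul_sum, Finset.sum_add_distrib, Finset.sum_add_distrib, ← Finset.mul_sum] at e3
    have e4 : ∑ _ε : Fin n → Bool, (η * d) ^ c.p = 2 ^ n * (η * d) ^ c.p := by simp
    rw [e4] at e3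
    have e5 := B.trans (mul_le_mul_of_nonneg_left e3 hCb)
    set X := ∑ ε, c.nrm (fun ω => u ω ε) ^ c.p
    set W := s ^ c.p * ∑ ε, c.nrm (fun ω => w ω ε) ^ c.p with hW
    set Q := 2 ^ n * (η * d) ^ c.p
    have hW0 : 0 ≤ W := by
      have : 0 ≤ ∑ ε, c.nrm (fun ω => w ω ε) ^ c.p :=
        Finset.sum_nonneg fun ε _ => Real.rpow_nonneg (c.nrm_nonneg _) _
      positivity
    have hQ0 : 0 ≤ Q := by positivity
    set c3 := c.Cb * 3 ^ c.p with hc3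
    have hc30 : 0 ≤ c3 := by positivity
    have e6 : s * X ≤ c3 * (W + X + Q) := e5.trans (le_of_eq (by rw [hc3]; ring))
    have hX0 : 0 ≤ X := Finset.sum_nonneg fun ε _ => Real.rpow_nonneg (c.nrm_nonneg _) _
    rw [hs] at e6
    by_contra hcon
    push Not at hcon
    nlinarith [mul_nonneg hc30 (sub_nonneg.2 hcon.le)]
  refine le_of_forall_pos_le_add fun δ hδ => ?_
  have := main ((δ / 2 ^ n) ^ (1 / c.p) / d) (by positivity)
  refine this.trans (le_of_eq ?_)
  congr 1
  rw [div_mul_cancel₀ _ hd0.ne', ← Real.rpow_mul (by positivity), one_div_mul_cancel hp.ne', Real.rpow_one]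
  field_simp

lemma core (F : Fin n → Ω → (Fin n → Bool) → ℝ)
    (hodd : ∀ i ω ε, F i ω (flipCoord i ε) = - F i ω ε) :
    ∑ ε, c.nrm (fun ω => mult m0 (fun ε => ∑ i, F i ω ε) ε) ^ c.p ≤
      c.Cf * ∑ ε, c.nrm (fun ω => Real.sqrt (∑ i, F i ω ε ^ 2)) ^ c.p := by
  rcases isEmpty_or_nonempty Ω with h | h
  · have hq := c.q0.ne'
    have hp := c.p0.ne'
    have : ∀ f : Ω → ℝ, c.nrm f = 0 := by
      intro f; unfold nrm; simp [hq]
    simp [this, hp]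
  · exact c.core_aux F hodd
end Par
end

noncomputable section

lemma rad_orth {n : ℕ} (i j : Fin n) : ∑ δ : Fin n → Bool, rad (δ i) * rad (δ j) = if i = j then (2:ℝ) ^ n else 0 := by
  have := walsh_orth ({i} : Finset (Fin n)) {j}
  simpa [walshChar] using this

lemma rad_sq {n : ℕ} (a : Fin n → ℝ) :
    ∑ i, a i ^ 2 = (2 ^ n : ℝ)⁻¹ * ∑ δ : Fin n → Bool, (∑ i, rad (δ i) * a i) ^ 2 := by
  have h : ∑ δ : Fin n → Bool, (∑ i, rad (δ i) * a i) ^ 2 = 2 ^ n * ∑ i, a i ^ 2 := by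
    simp only [sq, Finset.sum_mul_sum]
    rw [Finset.sum_comm, Finset.mul_sum]
    refine Finset.sum_congr rfl fun i _ => ?_
    rw [Finset.sum_comm]
    have : ∀ j, ∑ δ : Fin n → Bool, rad (δ i) * a i * (rad (δ j) * a j) = (if i = j then (2:ℝ) ^ n else 0) * (a i * a j) := by
      intro j
      rw [← rad_orth, Finset.sum_mul]
      exact Finset.sum_congr rfl fun _ _ => by ring
    simp [this]
  rw [h]; field_simp

lemma cube_jensen {n : ℕ} (z : (Fin n → Bool) → ℝ) (hz : ∀ δ, 0 ≤ z δ) (r : ℝ) (hr : 1 ≤ r) :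
    ((2 ^ n : ℝ)⁻¹ * ∑ δ, z δ) ^ r ≤ (2 ^ n : ℝ)⁻¹ * ∑ δ, z δ ^ r := by
  have := Real.rpow_arith_mean_le_arith_mean_rpow Finset.univ (fun _ : Fin n → Bool => (2 ^ n : ℝ)⁻¹) z
    (fun _ _ => by positivity) (by simp) (fun δ _ => hz δ) hr
  simpa only [Finset.mul_sum] using this

namespace Par
variable (c : Par) {n : ℕ} {Ω : Type} [Fintype Ω]

lemma khin (a : Fin n → Ω → ℝ) :
    c.nrm (fun ω => Real.sqrt (∑ i, a i ω ^ 2)) ^ c.p ≤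
      (2 ^ n : ℝ)⁻¹ * ∑ δ : Fin n → Bool, c.nrm (fun ω => ∑ i, rad (δ i) * a i ω) ^ c.p := by
  have hq := c.q0
  have h1 : c.nrm (fun ω => Real.sqrt (∑ i, a i ω ^ 2)) ^ c.q ≤
      (2 ^ n : ℝ)⁻¹ * ∑ δ : Fin n → Bool, c.nrm (fun ω => ∑ i, rad (δ i) * a i ω) ^ c.q := by
    simp only [nrm_pow]
    rw [Finset.sum_comm, Finset.mul_sum]
    refine Finset.sum_le_sum fun ω _ => ?_
    have e1 : |Real.sqrt (∑ i, a i ω ^ 2)| ^ c.q = (∑ i, a i ω ^ 2) ^ (c.q / 2) := by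
      rw [abs_of_nonneg (Real.sqrt_nonneg _), Real.sqrt_eq_rpow,
        ← Real.rpow_mul (Finset.sum_nonneg fun _ _ => sq_nonneg _)]
      congr 1; ring
    rw [e1, rad_sq]
    refine (cube_jensen _ (fun _ => sq_nonneg _) _ (by linarith [c.hq])).trans (le_of_eq ?_)
    congr 1
    refine Finset.sum_congr rfl fun δ _ => ?_
    rw [← sq_abs, ← Real.rpow_natCast, ← Real.rpow_mul (abs_nonneg _)]
    congr 1; push_cast; ring
  have e : ∀ x : ℝ, 0 ≤ x → x ^ c.p = (x ^ c.q) ^ (c.p / c.q) := by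
    intro x hx
    rw [← Real.rpow_mul hx, mul_div_cancel₀ _ hq.ne']
  have hpq : 1 ≤ c.p / c.q := by rw [le_div_iff₀ hq]; linarith [c.hqp]
  rw [e _ (c.nrm_nonneg _)]
  refine (Real.rpow_le_rpow (Real.rpow_nonneg (c.nrm_nonneg _) _) h1 (by linarith)).trans ?_
  refine (cube_jensen _ (fun δ => Real.rpow_nonneg (c.nrm_nonneg _) _) _ hpq).trans (le_of_eq ?_)
  simp only [← e _ (c.nrm_nonneg _)]

end Par

section lin
variable {n : ℕ} {X Y : Type*} [AddCommGroup X] [Module ℝ X] [AddCommGroup Y] [Module ℝ Y]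

lemma map_wcoef (T : X →ₗ[ℝ] Y) (f : (Fin n → Bool) → X) (A) : T (wcoef f A) = wcoef (fun ε => T (f ε)) A := by
  simp [wcoef, cubeAvg]

lemma map_Dop (T : X →ₗ[ℝ] Y) (i : Fin n) (f : (Fin n → Bool) → X) (ε) : T (Dop i f ε) = Dop i (fun ε => T (f ε)) ε := by
  simp [Dop]

lemma map_lapPow (T : X →ₗ[ℝ] Y) (a : ℝ) (f : (Fin n → Bool) → X) (ε) :
    T (lapPow a f ε) = lapPow a (fun ε => T (f ε)) ε := by
  simp [lapPow, map_wcoef]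

/-- left hand combination -/
def lhsF (f : Fin n → (Fin n → Bool) → X) (ε : Fin n → Bool) : X := ∑ i, lapPow (-(1 / 2)) (Dop i (f i)) ε
/-- right hand combination -/
def rhsF (f : Fin n → (Fin n → Bool) → X) (δ ε : Fin n → Bool) : X := ∑ i, rad (δ i) • Dop i (f i) ε

lemma map_lhsF (T : X →ₗ[ℝ] Y) (f : Fin n → (Fin n → Bool) → X) (ε) :
    T (lhsF f ε) = lhsF (fun i ε => T (f i ε)) ε := by
  simp only [lhsF, map_sum, map_lapPow]
  refine Finset.sum_congr rfl fun i _ => ?_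
  congr 1; funext ε; rw [map_Dop]

lemma map_rhsF (T : X →ₗ[ℝ] Y) (f : Fin n → (Fin n → Bool) → X) (δ ε) :
    T (rhsF f δ ε) = rhsF (fun i ε => T (f i ε)) δ ε := by
  simp only [rhsF, map_sum, map_smul, map_Dop]

end lin

lemma lapPow_mult {n : ℕ} (f : (Fin n → Bool) → ℝ) : lapPow (-(1 / 2)) f = mult m0 f := by
  funext ε
  unfold lapPow mult m0
  rw [Finset.sum_filter]
  refine Finset.sum_congr rfl fun A _ => ?_
  split_ifs <;> simp_all

namespace Par
variable (c : Par) {n : ℕ} {Ω : Type} [Fintype Ω]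

lemma Cf_nonneg : 0 ≤ c.Cf := by
  unfold Cf; have := c.Cb_nonneg; positivity

lemma fin_thm (f : Fin n → (Fin n → Bool) → Ω → ℝ) :
    cubeAvg (fun ε => c.nrm (lhsF f ε) ^ c.p) ≤
      c.Cf * cubeAvg (fun δ : Fin n → Bool => cubeAvg (fun ε => c.nrm (rhsF f δ ε) ^ c.p)) := by
  set F : Fin n → Ω → (Fin n → Bool) → ℝ := fun i ω => Dop i (fun ε => f i ε ω) with hF
  have hodd : ∀ i ω ε, F i ω (flipCoord i ε) = - F i ω ε := by
    intro i ω ε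
    simp only [hF, Dop, cflip_flip, smul_eq_mul]; ring
  have h := c.core F hodd
  have e1 : ∀ ε, lhsF f ε = fun ω => mult m0 (fun ε => ∑ i, F i ω ε) ε := by
    intro ε; funext ω
    have := map_lhsF (LinearMap.proj ω : (Ω → ℝ) →ₗ[ℝ] ℝ) f ε
    simp only [LinearMap.proj_apply] at this
    rw [this, mult_sum]
    unfold lhsF
    simp only [lapPow_mult, hF]
  have e2 : ∀ δ ε, rhsF f δ ε = fun ω => ∑ i, rad (δ i) * F i ω ε := by
    intro δ ε; funext ω
    have := map_rhsF (LinearMap.proj ω : (Ω → ℝ) →ₗ[ℝ] ℝ) f δ ε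
    simp only [LinearMap.proj_apply] at this
    rw [this]
    unfold rhsF
    simp only [smul_eq_mul, hF]
  have h2 := Finset.sum_le_sum fun ε (_ : ε ∈ (Finset.univ : Finset (Fin n → Bool))) => c.khin (fun i ω => F i ω ε)
  have h3 := h.trans (mul_le_mul_of_nonneg_left h2 c.Cf_nonneg)
  simp only [e1, e2, cubeAvg, smul_eq_mul]
  have h4 := mul_le_mul_of_nonneg_left h3 (show 0 ≤ (2 ^ n : ℝ)⁻¹ by positivity)
  refine h4.trans (le_of_eq ?_)
  simp only [← Finset.mul_sum]
  rw [Finset.sum_comm]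
  ring
end Par
end

noncomputable section
open MeasureTheory

/-- Joint simple function. -/
def jointSF {J : Type} [Fintype J] {Ω : Type*} [MeasurableSpace Ω] (s : J → SimpleFunc Ω ℝ) :
    SimpleFunc Ω (J → ℝ) where
  toFun ω j := s j ω
  measurableSet_fiber' v := by
    have : (fun ω j => s j ω) ⁻¹' {v} = ⋂ j, (s j) ⁻¹' {v j} := by
      ext ω; simp [funext_iff]
    rw [this]
    exact MeasurableSet.iInter fun j => (s j).measurableSet_fiber _
  finite_range' := by
    refine (Set.Finite.pi (fun j => (s j).finite_range)).subset ?_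
    rintro _ ⟨ω, rfl⟩ j _
    exact ⟨ω, rfl⟩

lemma simple_model (c : Par) [Fact (1 ≤ ENNReal.ofReal c.q)] {J : Type} [Fintype J]
    {Ω : Type*} [MeasurableSpace Ω]
    (ν : Measure Ω) (x : J → Lp.simpleFunc ℝ (ENNReal.ofReal c.q) ν) :
    ∃ (W : Type) (_ : Fintype W) (Ψ : (J → ℝ) →ₗ[ℝ] (W → ℝ)),
      ∀ a : J → ℝ, ‖∑ j, a j • (x j : Lp ℝ (ENNReal.ofReal c.q) ν)‖ = c.nrm (Ψ a) := by
  have hq0 : 0 < c.q := c.q0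
  have hP0 : ENNReal.ofReal c.q ≠ 0 := by simpa using hq0
  set s : J → SimpleFunc Ω ℝ := fun j => Lp.simpleFunc.toSimpleFunc (x j) with hs
  set S := jointSF s with hS
  refine ⟨{v // v ∈ S.range}, inferInstance,
    { toFun := fun a v => (∑ j, a j * v.1 j) * (ν (S ⁻¹' {v.1})).toReal ^ (1 / c.q)
      map_add' := ?_
      map_smul' := ?_ }, ?_⟩
  · intro a b; ext v; simp [add_mul, Finset.sum_add_distrib]
  · intro r a; ext v; simp [Finset.mul_sum, mul_assoc, Finset.sum_mul]
  intro a
  have hfin : ∀ v : J → ℝ, v ≠ 0 → ν (S ⁻¹' {v}) < ⊤ := by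
    intro v hv
    obtain ⟨j, hj⟩ := Function.ne_iff.1 hv
    refine lt_of_le_of_lt (measure_mono ?_)
      (SimpleFunc.measure_preimage_lt_top_of_memLp hP0 ENNReal.ofReal_ne_top (s j)
        (Lp.simpleFunc.memLp (x j)) (v j) hj)
    intro ω hω
    have : S ω = v := hω
    show s j ω = v j
    rw [← this]; rfl
  have hae : ((∑ j, a j • (x j : Lp ℝ (ENNReal.ofReal c.q) ν) : Lp ℝ (ENNReal.ofReal c.q) ν) : Ω → ℝ)
      =ᵐ[ν] fun ω => ∑ j, a j * S ω j := by
    have key : ∀ T : Finset J,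
        ((∑ j ∈ T, a j • (x j : Lp ℝ (ENNReal.ofReal c.q) ν) : Lp ℝ (ENNReal.ofReal c.q) ν) : Ω → ℝ)
        =ᵐ[ν] fun ω => ∑ j ∈ T, a j * S ω j := by
      classical
      intro T
      induction T using Finset.induction_on with
      | empty =>
        simp only [Finset.sum_empty]
        exact Lp.coeFn_zero _ _ _
      | insert j T hj ih =>
        simp only [Finset.sum_insert hj]
        filter_upwards [Lp.coeFn_add (a j • (x j : Lp ℝ (ENNReal.ofReal c.q) ν))
          (∑ j ∈ T, a j • (x j : Lp ℝ (ENNReal.ofReal c.q) ν)), ih,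
          Lp.coeFn_smul (a j) (x j : Lp ℝ (ENNReal.ofReal c.q) ν),
          Lp.simpleFunc.toSimpleFunc_eq_toFun (x j)] with ω h1 h2 h3 h4
        rw [h1, Pi.add_apply, h2, h3, Pi.smul_apply, smul_eq_mul, ← h4]
        rfl
    exact key univ
  rw [Lp.norm_def, eLpNorm_congr_ae hae,
    eLpNorm_eq_lintegral_rpow_enorm_toReal hP0 ENNReal.ofReal_ne_top,
    ENNReal.toReal_ofReal hq0.le]
  have h1 : (∫⁻ ω, ‖∑ j, a j * S ω j‖ₑ ^ c.q ∂ν)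
      = ∑ v ∈ S.range, ‖∑ j, a j * v j‖ₑ ^ c.q * ν (S ⁻¹' {v}) := by
    rw [← SimpleFunc.map_lintegral (fun v : J → ℝ => ‖∑ j, a j * v j‖ₑ ^ c.q) S,
      ← SimpleFunc.lintegral_eq_lintegral]
    rfl
  rw [h1]
  have hterm : ∀ v : J → ℝ, ‖∑ j, a j * v j‖ₑ ^ c.q * ν (S ⁻¹' {v}) =
      ENNReal.ofReal (|(∑ j, a j * v j) * (ν (S ⁻¹' {v})).toReal ^ (1 / c.q)| ^ c.q) := by
    intro v
    have hr : |(∑ j, a j * v j) * (ν (S ⁻¹' {v})).toReal ^ (1 / c.q)| ^ c.q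
        = |∑ j, a j * v j| ^ c.q * (ν (S ⁻¹' {v})).toReal := by
      rw [abs_mul, Real.mul_rpow (abs_nonneg _) (abs_nonneg _),
        abs_of_nonneg (Real.rpow_nonneg ENNReal.toReal_nonneg _),
        ← Real.rpow_mul ENNReal.toReal_nonneg, one_div, inv_mul_cancel₀ hq0.ne', Real.rpow_one]
    rw [hr]
    by_cases hv : v = 0
    · subst hv
      simp [hq0, Real.zero_rpow hq0.ne']
    · rw [ENNReal.ofReal_mul (Real.rpow_nonneg (abs_nonneg _) _),
        ENNReal.ofReal_toReal (hfin v hv).ne, ← ENNReal.ofReal_rpow_of_nonneg (abs_nonneg _) hq0.le,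
        Real.enorm_eq_ofReal_abs]
  rw [Finset.sum_congr rfl (fun v _ => hterm v), ← ENNReal.ofReal_sum_of_nonneg
    (fun v _ => Real.rpow_nonneg (abs_nonneg _) _), ← ENNReal.toReal_rpow, ENNReal.toReal_ofReal
    (Finset.sum_nonneg fun v _ => Real.rpow_nonneg (abs_nonneg _) _)]
  unfold Par.nrm
  congr 1
  exact (Finset.sum_coe_sort S.range
    (fun v => |(∑ j, a j * v j) * (ν (S ⁻¹' {v})).toReal ^ (1 / c.q)| ^ c.q)).symm

lemma simple_thm (c : Par) [Fact (1 ≤ ENNReal.ofReal c.q)] {n : ℕ}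
    {Ω : Type*} [MeasurableSpace Ω] (ν : Measure Ω)
    (x : Fin n → (Fin n → Bool) → Lp.simpleFunc ℝ (ENNReal.ofReal c.q) ν) :
    cubeAvg (fun ε => ‖lhsF (fun i ε => (x i ε : Lp ℝ (ENNReal.ofReal c.q) ν)) ε‖ ^ c.p) ≤
      c.Cf * cubeAvg (fun δ : Fin n → Bool => cubeAvg (fun ε =>
        ‖rhsF (fun i ε => (x i ε : Lp ℝ (ENNReal.ofReal c.q) ν)) δ ε‖ ^ c.p)) := by
  classical
  obtain ⟨W, hW, Ψ, hΨ⟩ := simple_model c ν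
    (fun j : Fin n × (Fin n → Bool) => x j.1 j.2)
  let Φ : (Fin n × (Fin n → Bool) → ℝ) →ₗ[ℝ] Lp ℝ (ENNReal.ofReal c.q) ν :=
    { toFun := fun a => ∑ j, a j • (x j.1 j.2 : Lp ℝ (ENNReal.ofReal c.q) ν)
      map_add' := fun a b => by simp [add_smul, Finset.sum_add_distrib]
      map_smul' := fun r a => by simp [Finset.smul_sum, mul_smul] }
  let fW : Fin n → (Fin n → Bool) → (Fin n × (Fin n → Bool) → ℝ) :=
    fun i ε => Pi.single (i, ε) 1
  have hf : (fun i ε => (x i ε : Lp ℝ (ENNReal.ofReal c.q) ν)) = fun i ε => Φ (fW i ε) := by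
    funext i ε
    show _ = ∑ j, fW i ε j • (x j.1 j.2 : Lp ℝ (ENNReal.ofReal c.q) ν)
    rw [Finset.sum_eq_single (i, ε)]
    · simp [fW]
    · intro j _ hj; simp [fW, hj]
    · simp
  have hn : ∀ a, ‖Φ a‖ = c.nrm (Ψ a) := hΨ
  rw [hf]
  simp only [← map_lhsF, ← map_rhsF, hn]
  simp only [map_lhsF, map_rhsF]
  exact c.fin_thm _

lemma lp_thm (c : Par) [Fact (1 ≤ ENNReal.ofReal c.q)] {n : ℕ}
    {Ω : Type*} [MeasurableSpace Ω] (ν : Measure Ω)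
    (f : Fin n → (Fin n → Bool) → Lp ℝ (ENNReal.ofReal c.q) ν) :
    cubeAvg (fun ε => ‖lhsF f ε‖ ^ c.p) ≤
      c.Cf * cubeAvg (fun δ : Fin n → Bool => cubeAvg (fun ε => ‖rhsF f δ ε‖ ^ c.p)) := by
  have hd : DenseRange (Pi.map (fun _ : Fin n => Pi.map (fun _ : Fin n → Bool =>
      (Subtype.val : Lp.simpleFunc ℝ (ENNReal.ofReal c.q) ν → Lp ℝ (ENNReal.ofReal c.q) ν)))) :=
    DenseRange.piMap fun _ => DenseRange.piMap fun _ =>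
      Lp.simpleFunc.denseRange ENNReal.ofReal_ne_top
  refine hd.induction_on f ?_ (fun x => simple_thm c ν x)
  have hp : 0 ≤ c.p := c.p0.le
  have hcl : ∀ ε, Continuous (fun f : Fin n → (Fin n → Bool) → Lp ℝ (ENNReal.ofReal c.q) ν =>
      lhsF f ε) := by
    intro ε
    unfold lhsF lapPow wcoef cubeAvg Dop
    fun_prop
  have hcr : ∀ δ ε, Continuous (fun f : Fin n → (Fin n → Bool) → Lp ℝ (ENNReal.ofReal c.q) ν =>
      rhsF f δ ε) := by
    intro δ ε
    unfold rhsF Dop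
    fun_prop
  refine isClosed_le ?_ ?_
  · simp only [cubeAvg, smul_eq_mul]
    exact continuous_const.mul (continuous_finsetSum _ fun ε _ =>
      ((hcl ε).norm.rpow_const fun _ => Or.inr hp))
  · simp only [cubeAvg, smul_eq_mul]
    exact continuous_const.mul (continuous_const.mul (continuous_finsetSum _ fun δ _ =>
      (continuous_const.mul (continuous_finsetSum _ fun ε _ =>
        ((hcr δ ε).norm.rpow_const fun _ => Or.inr hp)))))

end

open MeasureTheory in
/-- Riesz estimate from below for `L^q(ν)`-valued functions,
`2 ≤ q ≤ p < ∞`. -/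
theorem riesz_below_Lq.{u} (q p : ℝ) (hq : 2 ≤ q) (hqp : q ≤ p)
    [Fact (1 ≤ ENNReal.ofReal q)] :
    ∃ C : ℝ, ∀ (Ω : Type u) [MeasurableSpace Ω] (ν : Measure Ω)
      (n : ℕ) (f : Fin n → (Fin n → Bool) → Lp ℝ (ENNReal.ofReal q) ν),
        cubeAvg (fun ε => ‖∑ i, lapPow (-(1 / 2)) (Dop i (f i)) ε‖ ^ p) ≤
          C * cubeAvg (fun δ : Fin n → Bool => cubeAvg (fun ε =>
            ‖∑ i, rad (δ i) • Dop i (f i) ε‖ ^ p)) := by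
  refine ⟨(⟨q, p, hq, hqp⟩ : Par).Cf, ?_⟩
  intro Ω _ ν n f
  have key := @lp_thm ⟨q, p, hq, hqp⟩ _ n Ω _ ν f
  exact key

end
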